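/- arXiv:2312.17514 — 3 statements merged into one kernel-verified Lean document; each statement's English description precedes it below -/
import Mathlib

section
/- Let s > 3/2 and t ≥ 0. There exists C > 0, depending only on s, such that the following holds. Let α, β : ℤ → ℂ satisfy Nα² := Σ_{j∈ℤ} ⟨j⟩^{2(s−1)} |j α_j|² < ∞ and Nβ² := Σ_{k∈ℤ} ⟨k⟩^{2(s−1)} |k β_k|² < ∞, and define u(τ,θ) = Σ_{j∈ℤ} α_j e^{ijθ} e^{−|j|τ} and v(τ,θ) = Σ_{k∈ℤ} β_k e^{ikθ} e^{−|k|τ} for τ ≥ 0 and θ ∈ ℝ/2πℤ. Let A : ℝ/2πℤ → M₂(ℂ) be a matrix-valued function whose four entries a are given by Fourier series a(θ) = Σ_{ℓ∈ℤ} â(ℓ) e^{iℓθ} with N_A(t)² := max over the four entries of Σ_{ℓ∈ℤ} ⟨ℓ⟩^{2(s−1)} e^{2|ℓ|t} |â(ℓ)|² < ∞, and assume that for every θ the matrix A(θ) satisfies the elliptic null condition. Define F(t,θ) := Σ_{a,b∈{1,2}} A(θ)_{ab} ∂_a u(t,θ) ∂_b v(t,θ), where ∂₁ = ∂_τ (derivative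 in the first variable, evaluated at τ = t) and ∂₂ = ∂_θ, and let F̂(t,m) denote the m-th Fourier coefficient of θ ↦ F(t,θ). Then Σ_{m∈ℤ} ⟨m⟩^{2(s−1)} e^{2|m|t} |F̂(t,m)|² ≤ C² e^{−4t} N_A(t)² Nα² Nβ². -/
open MeasureTheory Real

/-- The linear solution (with no growing modes) on `[0,∞) × S¹` with Fourier data `α`:
`(τ, θ) ↦ Σ_{j∈ℤ} α_j e^{ijθ} e^{−|j|τ}`. -/
noncomputable def linSol (α : ℤ → ℂ) (τ θ : ℝ) : ℂ :=
  ∑' j : ℤ, α j * Complex.exp (Complex.I * (j : ℂ) * (θ : ℂ)) *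
    ((Real.exp (-(|j| : ℝ) * τ) : ℝ) : ℂ)

/-- Partial derivative of a function on `ℝ × ℝ/2πℤ`: `∂₁ = ∂_τ` and `∂₂ = ∂_θ`. -/
noncomputable def pderivCyl (a : Fin 2) (f : ℝ → ℝ → ℂ) (t θ : ℝ) : ℂ :=
  if a = 0 then deriv (fun τ => f τ θ) t else deriv (fun θ' => f t θ') θ

/-- The null form `F(t,θ) = Σ_{a,b} A(θ)_{ab} ∂_a u(t,θ) ∂_b v(t,θ)` applied to the gradients
of the linear solutions with data `α` and `β`. -/
noncomputable def nullForm (A : ℝ → Matrix (Fin 2) (Fin 2) ℂ) (α β : ℤ → ℂ) (t θ : ℝ) : ℂ :=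
  ∑ a : Fin 2, ∑ b : Fin 2,
    A θ a b * pderivCyl a (linSol α) t θ * pderivCyl b (linSol β) t θ

/-- The `m`-th Fourier coefficient of a `2π`-periodic function on `ℝ`. -/
noncomputable def fourierCoef (f : ℝ → ℂ) (m : ℤ) : ℂ :=
  (1 / (2 * Real.pi)) * ∫ θ in (0:ℝ)..(2 * Real.pi),
    f θ * Complex.exp (-Complex.I * (m : ℂ) * (θ : ℂ))

noncomputable def om (s : ℝ) (n : ℤ) : ENNReal := ENNReal.ofReal ((1 + (n:ℝ)^2)^((s-1)/2))

lemma om_sq (s : ℝ) (n : ℤ) : (om s n)^2 = ENNReal.ofReal ((1 + (n:ℝ)^2)^(s-1)) := by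
  have h : (0:ℝ) < 1 + (n:ℝ)^2 := by positivity
  rw [om, ← ENNReal.ofReal_pow (by positivity), ← Real.rpow_natCast, ← Real.rpow_mul h.le]
  congr 2; push_cast; ring

lemma om_ne_zero (s : ℝ) (n : ℤ) : om s n ≠ 0 := by
  have h : (0:ℝ) < 1 + (n:ℝ)^2 := by positivity
  simp only [om, ne_eq, ENNReal.ofReal_eq_zero, not_le]; positivity

lemma om_ne_top (s : ℝ) (n : ℤ) : om s n ≠ ⊤ := ENNReal.ofReal_ne_top

lemma cs_tsum {ι : Type*} (x y : ι → ENNReal) :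
    (∑' i, x i * y i)^2 ≤ (∑' i, (x i)^2) * ∑' i, (y i)^2 := by
  let _ : MeasurableSpace ι := ⊤
  have h := ENNReal.lintegral_mul_le_Lp_mul_Lq (Measure.count : Measure ι) (p := 2) (q := 2)
    (by constructor <;> norm_num) (f := x) (g := y)
    (measurable_from_top.aemeasurable) (measurable_from_top.aemeasurable)
  simp only [lintegral_count, Pi.mul_apply] at h
  calc _ ≤ _ := pow_le_pow_left' h 2
    _ = _ := by
      rw [mul_pow]
      simp only [← ENNReal.rpow_natCast, ← ENNReal.rpow_mul]
      norm_num

lemma summable_w (s : ℝ) (hs : 3/2 < s) : Summable (fun n : ℤ => ((1 + (n:ℝ)^2)^(s-1))⁻¹) := by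
  have h := Real.summable_abs_int_rpow (b := 2*(s-1)) (by linarith)
  refine Summable.of_norm_bounded_eventually h ?_
  have : {n : ℤ | ¬ ‖((1 + (n:ℝ)^2)^(s-1))⁻¹‖ ≤ |(n:ℝ)| ^ (-(2*(s-1)))} ⊆ {0} := by
    intro n hn
    by_contra h0
    apply hn
    have hn0 : (0:ℝ) < |(n:ℝ)| := by simpa using h0
    rw [Real.norm_of_nonneg (by positivity), Real.rpow_neg hn0.le, Real.rpow_mul hn0.le]
    gcongr
    · linarith
    · simp
  exact (Set.finite_singleton 0).subset this

noncomputable def SS (s : ℝ) : ENNReal := ∑' n : ℤ, ((om s n)⁻¹)^2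

lemma SS_ne_top (s : ℝ) (hs : 3/2 < s) : SS s ≠ ⊤ := by
  have h := summable_w s hs
  have : SS s = ENNReal.ofReal (∑' n : ℤ, ((1 + (n:ℝ)^2)^(s-1))⁻¹) := by
    rw [ENNReal.ofReal_tsum_of_nonneg (fun n => by positivity) h, SS]
    congr 1; ext n
    rw [← ENNReal.inv_pow, om_sq, ENNReal.ofReal_inv_of_pos (by positivity)]
  rw [this]; exact ENNReal.ofReal_ne_top

lemma om_add (s : ℝ) (hs : 3/2 < s) (j k : ℤ) :
    (om s (j+k))^2 ≤ ENNReal.ofReal (4^(s-1)) * ((om s j)^2 + (om s k)^2) := by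
  rw [om_sq, om_sq, om_sq, ← ENNReal.ofReal_add (by positivity) (by positivity),
    ← ENNReal.ofReal_mul (by positivity)]
  apply ENNReal.ofReal_le_ofReal
  push_cast
  have key : ∀ x y : ℝ, x^2 ≤ y^2 → (1 + (x+y)^2)^(s-1) ≤ 4^(s-1) * (1+y^2)^(s-1) := by
    intro x y h
    rw [← Real.mul_rpow (by norm_num) (by positivity)]
    apply Real.rpow_le_rpow (by positivity) _ (by linarith)
    nlinarith [sq_nonneg (x-y)]
  have p1 : 0 ≤ (4:ℝ)^(s-1) * (1 + (j:ℝ)^2)^(s-1) := by positivity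
  have p2 : 0 ≤ (4:ℝ)^(s-1) * (1 + (k:ℝ)^2)^(s-1) := by positivity
  rcases le_total ((j:ℝ)^2) ((k:ℝ)^2) with h | h
  · have := key _ _ h; linarith
  · have := key _ _ h; rw [add_comm (k:ℝ)] at this; linarith

noncomputable def CC (s : ℝ) : ENNReal := ENNReal.ofReal (4^(s-1)) * (SS s + SS s)

lemma CC_ne_top (s : ℝ) (hs : 3/2 < s) : CC s ≠ ⊤ := by
  have := SS_ne_top s hs
  simp [CC, ENNReal.mul_eq_top, this]

lemma conv_est (s : ℝ) (hs : 3/2 < s) (f g : ℤ → ENNReal) :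
    ∑' m, (om s m * ∑' j, f j * g (m - j))^2 ≤
      CC s * (∑' j, (om s j * f j)^2) * (∑' j, (om s j * g j)^2) := by
  have h1 : ∀ m : ℤ, (om s m * ∑' j, f j * g (m - j))^2 ≤
      CC s * ∑' j, ((om s j * f j) * (om s (m-j) * g (m-j)))^2 := by
    intro m
    have e : om s m * ∑' j, f j * g (m - j) =
        ∑' j, (om s m * (om s j)⁻¹ * (om s (m-j))⁻¹) * ((om s j * f j) * (om s (m-j) * g (m-j))) := by
      rw [← ENNReal.tsum_mul_left]
      congr 1; ext j
      have a1 := ENNReal.inv_mul_cancel (om_ne_zero s j) (om_ne_top s j)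
      have a2 := ENNReal.inv_mul_cancel (om_ne_zero s (m-j)) (om_ne_top s (m-j))
      calc _ = om s m * (f j * g (m-j)) * 1 * 1 := by ring
        _ = om s m * (f j * g (m-j)) * ((om s j)⁻¹ * om s j) * ((om s (m-j))⁻¹ * om s (m-j)) := by
          rw [a1, a2]
        _ = _ := by ring
    rw [e]
    refine (cs_tsum _ _).trans ?_
    gcongr
    have h2 : ∀ j : ℤ, (om s m * (om s j)⁻¹ * (om s (m-j))⁻¹)^2 ≤
        ENNReal.ofReal (4^(s-1)) * (((om s (m-j))⁻¹)^2 + ((om s j)⁻¹)^2) := by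
      intro j
      have h := om_add s hs j (m-j)
      rw [add_sub_cancel] at h
      have a1 := ENNReal.inv_mul_cancel (om_ne_zero s j) (om_ne_top s j)
      have a2 := ENNReal.inv_mul_cancel (om_ne_zero s (m-j)) (om_ne_top s (m-j))
      calc _ = (om s m)^2 * ((om s j)⁻¹^2 * (om s (m-j))⁻¹^2) := by ring
        _ ≤ (ENNReal.ofReal (4^(s-1)) * ((om s j)^2 + (om s (m-j))^2)) *
          ((om s j)⁻¹^2 * (om s (m-j))⁻¹^2) := by gcongr
        _ = ENNReal.ofReal (4^(s-1)) * (((om s j)⁻¹ * om s j)^2 * ((om s (m-j))⁻¹)^2 +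
           ((om s (m-j))⁻¹ * om s (m-j))^2 * ((om s j)⁻¹)^2) := by ring
        _ = _ := by rw [a1, a2]; simp
    refine (ENNReal.tsum_le_tsum h2).trans ?_
    rw [ENNReal.tsum_mul_left, ENNReal.tsum_add, CC, SS]
    rw [show ∑' a : ℤ, ((om s (m-a))⁻¹)^2 = ∑' a : ℤ, ((om s a)⁻¹)^2 from (Equiv.subLeft m).tsum_eq (fun j => ((om s j)⁻¹)^2)]
  refine (ENNReal.tsum_le_tsum h1).trans ?_
  rw [ENNReal.tsum_mul_left, ENNReal.tsum_comm, mul_assoc]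
  gcongr
  rw [← ENNReal.tsum_mul_right]
  refine ENNReal.tsum_le_tsum fun j => ?_
  simp only [mul_pow (om s j * f j)]
  rw [ENNReal.tsum_mul_left, show ∑' i : ℤ, (om s (i-j) * g (i-j))^2 = ∑' i : ℤ, (om s i * g i)^2 from (Equiv.subRight j).tsum_eq (fun k => (om s k * g k)^2)]

lemma l1_est (s : ℝ) (f : ℤ → ENNReal) : (∑' j, f j)^2 ≤ SS s * ∑' j, (om s j * f j)^2 := by
  have := cs_tsum (fun j => (om s j)⁻¹) (fun j => om s j * f j)
  refine le_trans (le_of_eq ?_) this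
  congr 2; ext j
  rw [← mul_assoc, ENNReal.inv_mul_cancel (om_ne_zero s j) (om_ne_top s j), one_mul]

lemma ofReal_eq_om (s : ℝ) (n : ℤ) (z : ℂ) :
    ENNReal.ofReal ((1 + (n : ℝ) ^ 2) ^ (s - 1) * ‖z‖ ^ 2) = (om s n * ‖z‖ₑ)^2 := by
  rw [mul_pow, om_sq, ENNReal.ofReal_mul (by positivity), ENNReal.ofReal_pow (by positivity),
    ofReal_norm]

lemma summable_of_wt (s : ℝ) (hs : 3/2 < s) (f : ℤ → ℂ)
    (h : ∑' n, (om s n * ‖f n‖ₑ)^2 ≠ ⊤) : Summable (fun n => ‖f n‖) := by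
  have h1 := l1_est s (fun n => ‖f n‖ₑ)
  have h2 : ∑' n, ‖f n‖ₑ ≠ ⊤ := by
    intro h3
    rw [h3] at h1
    simp only [ne_eq, OfNat.ofNat_ne_zero, not_false_eq_true, ENNReal.top_pow, top_le_iff] at h1
    exact (ENNReal.mul_ne_top (SS_ne_top s hs) h) h1
  have := ENNReal.summable_toReal h2
  simpa using this

lemma norm_exp_I (n : ℤ) (θ : ℝ) : ‖Complex.exp (Complex.I * (n : ℂ) * (θ : ℂ))‖ = 1 := by
  have : Complex.I * (n : ℂ) * (θ : ℂ) = ((n * θ : ℝ) : ℂ) * Complex.I := by push_cast; ring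
  rw [this, Complex.norm_exp_ofReal_mul_I]

lemma integral_exp_int (n : ℤ) : ∫ θ in (0:ℝ)..(2 * Real.pi),
    Complex.exp (Complex.I * (n : ℂ) * (θ : ℂ)) = if n = 0 then (2 * Real.pi : ℂ) else 0 := by
  split_ifs with h
  · subst h; simp
  · have hc : Complex.I * (n : ℂ) ≠ 0 := by simp [h]
    rw [integral_exp_mul_complex hc]
    have : Complex.I * (n : ℂ) * ((2 * Real.pi : ℝ) : ℂ) = n * (2 * Real.pi * Complex.I) := by
      push_cast; ring
    rw [this, Complex.exp_int_mul_two_pi_mul_I]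
    simp

lemma fourierCoef_tsum {ι : Type*} [Countable ι] (f : ι → ℂ) (φ : ι → ℤ)
    (hf : Summable (fun i => ‖f i‖)) (g : ℝ → ℂ)
    (hg : ∀ θ, g θ = ∑' i, f i * Complex.exp (Complex.I * (φ i : ℂ) * (θ : ℂ))) (m : ℤ) :
    fourierCoef g m = ∑' i, if φ i = m then f i else 0 := by
  have h : HasSum (fun i => ∫ θ in (0:ℝ)..(2 * Real.pi),
      f i * Complex.exp (Complex.I * ((φ i - m : ℤ) : ℂ) * (θ : ℂ)))
      (∫ θ in (0:ℝ)..(2 * Real.pi), g θ * Complex.exp (-Complex.I * (m : ℂ) * (θ : ℂ))) := by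
    apply intervalIntegral.hasSum_integral_of_dominated_convergence (fun i (x : ℝ) => ‖f i‖)
    · intro i
      apply Continuous.aestronglyMeasurable
      fun_prop
    · intro i
      filter_upwards with x hx
      rw [norm_mul, norm_exp_I, mul_one]
    · exact ae_of_all _ fun x _ => hf
    · exact intervalIntegrable_const
    · refine ae_of_all _ fun x _ => ?_
      have hs : Summable (fun i => f i * Complex.exp (Complex.I * (φ i : ℂ) * (x : ℂ))) := by
        apply Summable.of_norm
        simpa only [norm_mul, norm_exp_I, mul_one] using hf
      have := hs.hasSum.mul_right (Complex.exp (-Complex.I * (m : ℂ) * (x : ℂ)))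
      rw [← hg] at this
      refine this.congr_fun ?_
      intro i
      symm
      rw [mul_assoc, ← Complex.exp_add]
      congr 2; push_cast; ring
  rw [fourierCoef, ← h.tsum_eq, ← tsum_mul_left]
  congr 1; ext i
  rw [intervalIntegral.integral_const_mul, integral_exp_int]
  have : (Real.pi : ℂ) ≠ 0 := by exact_mod_cast Real.pi_ne_zero
  by_cases hi : φ i = m
  · simp [hi]; field_simp
  · simp [hi, sub_eq_zero]

lemma deriv_theta (α : ℤ → ℂ) (h0 : Summable (fun j => ‖α j‖))
    (h1 : Summable (fun j : ℤ => ‖(j:ℂ) * α j‖)) (t : ℝ) (ht : 0 ≤ t) (θ : ℝ) :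
    pderivCyl 1 (linSol α) t θ = ∑' j : ℤ, (Complex.I * j * α j * (Real.exp (-|(j:ℝ)| * t) : ℝ)) *
      Complex.exp (Complex.I * (j : ℂ) * (θ : ℂ)) := by
  have hle : ∀ j : ℤ, Real.exp (-|(j:ℝ)| * t) ≤ 1 := fun j => by
    rw [Real.exp_le_one_iff]; have := abs_nonneg (j:ℝ); nlinarith
  simp only [pderivCyl, one_ne_zero, if_false]
  unfold linSol
  apply HasDerivAt.deriv
  refine hasDerivAt_tsum (𝕜 := ℝ) (y₀ := 0)
    (g' := fun (j : ℤ) (y : ℝ) => (Complex.I * j * α j * (Real.exp (-|(j:ℝ)| * t) : ℝ)) *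
      Complex.exp (Complex.I * (j : ℂ) * (y : ℂ))) h1 ?_ ?_ ?_ θ
  · intro j y
    have e : HasDerivAt (fun y : ℝ => Complex.I * (j:ℂ) * (y:ℂ)) (Complex.I * (j:ℂ)) y := by
      simpa using (Complex.ofRealCLM.hasDerivAt (x := y)).const_mul (Complex.I * (j:ℂ))
    have := ((e.cexp).const_mul (α j)).mul_const ((Real.exp (-|(j:ℝ)| * t) : ℝ) : ℂ)
    refine this.congr_deriv ?_
    ring
  · intro j y
    rw [norm_mul, norm_exp_I, norm_mul, mul_one, Complex.norm_real, Real.norm_of_nonneg (Real.exp_pos _).le,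
      mul_assoc, norm_mul, Complex.norm_I, one_mul]
    exact mul_le_of_le_one_right (norm_nonneg _) (hle j)
  · refine Summable.of_norm_bounded h0 fun j => ?_
    rw [norm_mul, norm_mul, norm_exp_I, mul_one, Complex.norm_real, Real.norm_of_nonneg (Real.exp_pos _).le]
    exact mul_le_of_le_one_right (norm_nonneg _) (hle j)

lemma deriv_tau_aux (α : ℤ → ℂ) (h0 : Summable (fun j => ‖α j‖)) (t r : ℝ) (ht : 0 ≤ t) (hr : r < t)
    (h1 : Summable (fun j : ℤ => ‖(j:ℂ) * α j‖ * Real.exp (-|(j:ℝ)| * r))) (θ : ℝ) :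
    pderivCyl 0 (linSol α) t θ =
     ∑' j : ℤ, (-(|(j:ℝ)| : ℝ) * α j * (Real.exp (-|(j:ℝ)| * t) : ℝ)) *
      Complex.exp (Complex.I * (j : ℂ) * (θ : ℂ)) := by
  have hle : ∀ j : ℤ, Real.exp (-|(j:ℝ)| * t) ≤ 1 := fun j => by
    rw [Real.exp_le_one_iff]; have := abs_nonneg (j:ℝ); nlinarith
  simp only [pderivCyl, if_true]
  unfold linSol
  apply HasDerivAt.deriv
  refine hasDerivAt_tsum_of_isPreconnected (𝕜 := ℝ) (y₀ := t) (t := Set.Ioi r)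
    (g' := fun (j : ℤ) (y : ℝ) => (-(|(j:ℝ)| : ℝ) * α j * (Real.exp (-|(j:ℝ)| * y) : ℝ)) *
      Complex.exp (Complex.I * (j : ℂ) * (θ : ℂ))) h1 isOpen_Ioi isPreconnected_Ioi ?_ ?_ hr ?_ hr
  · intro j y hy
    have e : HasDerivAt (fun y : ℝ => Real.exp (-|(j:ℝ)| * y))
        (Real.exp (-|(j:ℝ)| * y) * (-|(j:ℝ)|)) y := by
      simpa using ((hasDerivAt_id y).const_mul (-|(j:ℝ)|)).exp
    have := (e.ofReal_comp).const_mul (α j * Complex.exp (Complex.I * (j : ℂ) * (θ : ℂ)))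
    refine this.congr_deriv ?_
    push_cast
    ring
  · intro j y hy
    rw [norm_mul, norm_exp_I, norm_mul, mul_one, Complex.norm_real, Real.norm_of_nonneg (Real.exp_pos _).le,
      norm_mul, norm_mul, norm_neg, Complex.norm_real, Real.norm_of_nonneg (abs_nonneg _),
      Complex.norm_intCast]
    have := abs_nonneg (j:ℝ)
    have hy' : r < y := hy
    gcongr ?_ * ?_
    rw [Real.exp_le_exp]
    nlinarith
  · refine Summable.of_norm_bounded h0 fun j => ?_
    rw [norm_mul, norm_mul, norm_exp_I, mul_one, Complex.norm_real, Real.norm_of_nonneg (Real.exp_pos _).le]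
    exact mul_le_of_le_one_right (norm_nonneg _) (hle j)

lemma deriv_tau (α : ℤ → ℂ) (h0 : Summable (fun j => ‖α j‖))
    (h1 : Summable (fun j : ℤ => ‖(j:ℂ) * α j‖)) (t : ℝ) (ht : 0 ≤ t) :
    ∃ c : ℤ → ℂ, (∀ j, ‖c j‖ ≤ ‖(j:ℂ) * α j‖ * Real.exp (-|(j:ℝ)| * t)) ∧
     (0 < t → ∀ j : ℤ, c j = -(|(j:ℝ)| : ℝ) * α j * (Real.exp (-|(j:ℝ)| * t) : ℝ)) ∧
     ∀ θ : ℝ, pderivCyl 0 (linSol α) t θ = ∑' j : ℤ, c j *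
      Complex.exp (Complex.I * (j : ℂ) * (θ : ℂ)) := by
  by_cases H : ∃ r < t, Summable (fun j : ℤ => ‖(j:ℂ) * α j‖ * Real.exp (-|(j:ℝ)| * r))
  · obtain ⟨r, hr, h⟩ := H
    refine ⟨_, ?_, fun _ j => rfl, deriv_tau_aux α h0 t r ht hr h⟩
    intro j
    rw [norm_mul, Complex.norm_real, Real.norm_of_nonneg (Real.exp_pos _).le,
      norm_mul, norm_mul, norm_neg, Complex.norm_real, Real.norm_of_nonneg (abs_nonneg _),
      Complex.norm_intCast]
  · have ht0 : t = 0 := by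
      by_contra hne
      exact H ⟨0, lt_of_le_of_ne ht (Ne.symm hne), by simpa using h1⟩
    subst ht0
    refine ⟨fun _ => 0, fun j => by simp; positivity, fun h => absurd h (lt_irrefl _), fun θ => ?_⟩
    have hz : ∀ τ < (0:ℝ), linSol α τ θ = 0 := by
      intro τ hτ
      apply tsum_eq_zero_of_not_summable
      intro hs
      apply H
      refine ⟨τ/2, by linarith, ?_⟩
      refine Summable.of_nonneg_of_le (fun j => by positivity) (fun j => ?_)
        (hs.norm.mul_left (2/(-τ)))
      rw [norm_mul, norm_mul, norm_mul, norm_exp_I, mul_one, Complex.norm_real,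
        Real.norm_of_nonneg (Real.exp_pos _).le, Complex.norm_intCast]
      have e1 : Real.exp (-|(j:ℝ)| * τ) = Real.exp (-|(j:ℝ)| * (τ/2)) * Real.exp (-|(j:ℝ)| * (τ/2)) := by
        rw [← Real.exp_add]; ring_nf
      have e2 : |(j:ℝ)| ≤ 2/(-τ) * Real.exp (-|(j:ℝ)| * (τ/2)) := by
        have := Real.add_one_le_exp (-|(j:ℝ)| * (τ/2))
        rw [div_mul_eq_mul_div, le_div_iff₀ (by linarith)]
        linarith
      rw [e1]
      calc _ ≤ (2/(-τ) * Real.exp (-|(j:ℝ)| * (τ/2))) * ‖α j‖ * Real.exp (-|(j:ℝ)| * (τ/2)) := by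
            gcongr
        _ = _ := by ring
    simp only [pderivCyl, if_true, zero_mul, tsum_zero]
    by_cases hd : DifferentiableAt ℝ (fun τ => linSol α τ θ) 0
    · have hev : (fun τ => linSol α τ θ) =ᶠ[nhdsWithin 0 (Set.Iio 0)] fun _ => 0 := by
        filter_upwards [self_mem_nhdsWithin] with τ hτ using hz τ hτ
      have hc : Filter.Tendsto (fun τ => linSol α τ θ) (nhdsWithin 0 (Set.Iio 0)) (nhds (linSol α 0 θ)) :=
        hd.continuousAt.tendsto.mono_left nhdsWithin_le_nhds
      have hz0 : linSol α 0 θ = 0 :=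
        tendsto_nhds_unique hc (tendsto_const_nhds.congr' hev.symm)
      have h2 : HasDerivWithinAt (fun τ => linSol α τ θ) 0 (Set.Iio 0) 0 :=
        (hasDerivWithinAt_const (0:ℝ) (Set.Iio 0) (0:ℂ)).congr_of_eventuallyEq hev hz0
      exact (uniqueDiffWithinAt_Iio (0:ℝ)).eq_deriv _ hd.hasDerivAt.hasDerivWithinAt h2
    · exact deriv_zero_of_not_differentiableAt hd
lemma kernel_bound (t : ℝ) (ht : 0 ≤ t) (ℓ j k : ℤ) (a b : ℂ) (B : Fin 2 → Fin 2 → ℂ)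
    (c d : Fin 2 → ℂ)
    (hB1 : B 0 0 = B 1 1) (hB2 : B 1 0 = - B 0 1)
    (hc : ∀ x, ‖c x‖ ≤ ‖(j:ℂ) * a‖ * Real.exp (-|(j:ℝ)| * t))
    (hd : ∀ x, ‖d x‖ ≤ ‖(k:ℂ) * b‖ * Real.exp (-|(k:ℝ)| * t))
    (hc0 : 0 < t → c 0 = -(|(j:ℝ)| : ℝ) * a * (Real.exp (-|(j:ℝ)| * t) : ℝ))
    (hd0 : 0 < t → d 0 = -(|(k:ℝ)| : ℝ) * b * (Real.exp (-|(k:ℝ)| * t) : ℝ))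
    (hc1 : c 1 = Complex.I * j * a * (Real.exp (-|(j:ℝ)| * t) : ℝ))
    (hd1 : d 1 = Complex.I * k * b * (Real.exp (-|(k:ℝ)| * t) : ℝ)) :
    ‖∑ x, ∑ y, B x y * (c x * d y)‖ * Real.exp (|((ℓ + j + k : ℤ) : ℝ)| * t) ≤
      Real.exp (-2 * t) * ((Real.exp (|(ℓ:ℝ)| * t) * ∑ x, ∑ y, ‖B x y‖) *
        (‖(j:ℂ) * a‖ * ‖(k:ℂ) * b‖)) := by
  have hsum : ‖∑ x, ∑ y, B x y * (c x * d y)‖ ≤ (∑ x, ∑ y, ‖B x y‖) *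
      ((‖(j:ℂ) * a‖ * Real.exp (-|(j:ℝ)| * t)) * (‖(k:ℂ) * b‖ * Real.exp (-|(k:ℝ)| * t))) := by
    simp only [Finset.sum_mul]
    refine (norm_sum_le _ _).trans (Finset.sum_le_sum fun x _ => ?_)
    refine (norm_sum_le _ _).trans (Finset.sum_le_sum fun y _ => ?_)
    rw [norm_mul, norm_mul]
    have := hc x
    have := hd y
    gcongr
  have hmain : (|ℓ + j + k| + 2 ≤ |ℓ| + |j| + |k|) ∨ t = 0 →
    ‖∑ x, ∑ y, B x y * (c x * d y)‖ * Real.exp (|((ℓ + j + k : ℤ) : ℝ)| * t) ≤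
      Real.exp (-2 * t) * ((Real.exp (|(ℓ:ℝ)| * t) * ∑ x, ∑ y, ‖B x y‖) *
        (‖(j:ℂ) * a‖ * ‖(k:ℂ) * b‖)) := by
    intro h
    have h' : -|(j:ℝ)| * t + -|(k:ℝ)| * t + |((ℓ + j + k : ℤ) : ℝ)| * t ≤ -2 * t + |(ℓ:ℝ)| * t := by
      rcases h with h | h
      · have : |((ℓ + j + k : ℤ) : ℝ)| + 2 ≤ |(ℓ:ℝ)| + |(j:ℝ)| + |(k:ℝ)| := by exact_mod_cast h
        nlinarith
      · simp [h]
    rw [← Real.exp_le_exp, Real.exp_add, Real.exp_add, Real.exp_add] at h'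
    calc _ ≤ (∑ x, ∑ y, ‖B x y‖) *
      ((‖(j:ℂ) * a‖ * Real.exp (-|(j:ℝ)| * t)) * (‖(k:ℂ) * b‖ * Real.exp (-|(k:ℝ)| * t))) *
        Real.exp (|((ℓ + j + k : ℤ) : ℝ)| * t) := by gcongr
      _ = ((∑ x, ∑ y, ‖B x y‖) * (‖(j:ℂ) * a‖ * ‖(k:ℂ) * b‖)) *
        (Real.exp (-|(j:ℝ)| * t) * Real.exp (-|(k:ℝ)| * t) *
          Real.exp (|((ℓ + j + k : ℤ) : ℝ)| * t)) := by ring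
      _ ≤ ((∑ x, ∑ y, ‖B x y‖) * (‖(j:ℂ) * a‖ * ‖(k:ℂ) * b‖)) *
        (Real.exp (-2 * t) * Real.exp (|(ℓ:ℝ)| * t)) := by gcongr
      _ = _ := by ring
  rcases ht.eq_or_lt with h0 | h0
  · exact hmain (Or.inr h0.symm)
  have hz : |j| * |k| = j * k → |j| * k = j * |k| → 
      ‖∑ x, ∑ y, B x y * (c x * d y)‖ * Real.exp (|((ℓ + j + k : ℤ) : ℝ)| * t) ≤
      Real.exp (-2 * t) * ((Real.exp (|(ℓ:ℝ)| * t) * ∑ x, ∑ y, ‖B x y‖) *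
        (‖(j:ℂ) * a‖ * ‖(k:ℂ) * b‖)) := by
    intro e1 e2
    have e1' : ((|(j:ℝ)| : ℝ) : ℂ) * ((|(k:ℝ)| : ℝ) : ℂ) = j * k := by exact_mod_cast e1
    have e2' : ((|(j:ℝ)| : ℝ) : ℂ) * k = j * ((|(k:ℝ)| : ℝ) : ℂ) := by exact_mod_cast e2
    have : ∑ x, ∑ y, B x y * (c x * d y) = 0 := by
      simp only [Fin.sum_univ_two]
      rw [hc0 h0, hd0 h0, hc1, hd1, hB1, hB2]
      generalize ((Real.exp (-|(j:ℝ)| * t) : ℝ) : ℂ) = E1 at *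
      generalize ((Real.exp (-|(k:ℝ)| * t) : ℝ) : ℂ) = E2 at *
      generalize ((|(j:ℝ)| : ℝ) : ℂ) = J at *
      generalize ((|(k:ℝ)| : ℝ) : ℂ) = K at *
      linear_combination (B 1 1 * a * E1 * b * E2) * e1' - (B 0 1 * Complex.I * a * E1 * b * E2) * e2'
        + B 1 1 * j * k * a * b * E1 * E2 * Complex.I_mul_I
    rw [this, norm_zero, zero_mul]
    positivity
  rcases le_or_gt 0 j with hj | hj <;> rcases le_or_gt 0 k with hk | hk
  · exact hz (by rw [abs_of_nonneg hj, abs_of_nonneg hk]) (by rw [abs_of_nonneg hj, abs_of_nonneg hk])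
  · rcases hj.eq_or_lt with h | h
    · exact hz (by simp [← h]) (by simp [← h])
    · exact hmain (Or.inl (by grind))
  · rcases hk.eq_or_lt with h | h
    · exact hz (by simp [← h]) (by simp [← h])
    · exact hmain (Or.inl (by grind))
  · exact hz (by rw [abs_of_neg hj, abs_of_neg hk]; ring) (by rw [abs_of_neg hj, abs_of_neg hk]; ring)

lemma triple_expand (X : Fin 2 → Fin 2 → ℤ → ℂ) (c d : Fin 2 → ℤ → ℂ)
    (hX : ∀ a b, Summable (fun n => ‖X a b n‖)) (hc : ∀ a, Summable (fun n => ‖c a n‖))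
    (hd : ∀ a, Summable (fun n => ‖d a n‖)) (F : ℝ → ℂ)
    (hF : ∀ θ : ℝ, F θ = ∑ a, ∑ b,
      (∑' n : ℤ, X a b n * Complex.exp (Complex.I * (n : ℂ) * (θ : ℂ))) *
      (∑' n : ℤ, c a n * Complex.exp (Complex.I * (n : ℂ) * (θ : ℂ))) *
      (∑' n : ℤ, d b n * Complex.exp (Complex.I * (n : ℂ) * (θ : ℂ)))) (m : ℤ) :
    ‖fourierCoef F m‖ₑ ≤ ∑' ℓ : ℤ, ∑' j : ℤ,
      ‖∑ a, ∑ b, X a b ℓ * (c a j * d b (m - ℓ - j))‖ₑ := by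
  have hs1 : ∀ a b, Summable (fun p : ℤ × ℤ × ℤ => ‖X a b p.1 * (c a p.2.1 * d b p.2.2)‖) :=
    fun a b => (hX a b).mul_norm (g := fun p : ℤ × ℤ => c a p.1 * d b p.2) ((hc a).mul_norm (hd b))
  have hs : Summable (fun p : ℤ × ℤ × ℤ => ‖∑ a, ∑ b, X a b p.1 * (c a p.2.1 * d b p.2.2)‖) := by
    apply Summable.norm
    exact summable_sum fun a _ => summable_sum fun b _ => (hs1 a b).of_norm
  have key := fourierCoef_tsum (fun p : ℤ × ℤ × ℤ => ∑ a, ∑ b, X a b p.1 * (c a p.2.1 * d b p.2.2))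
    (fun p => p.1 + p.2.1 + p.2.2) hs F ?_ m
  · rw [key]
    refine enorm_tsum_le_tsum_enorm.trans ?_
    rw [ENNReal.tsum_prod (f := fun ℓ (q : ℤ × ℤ) => ‖if ℓ + q.1 + q.2 = m then
      ∑ a, ∑ b, X a b ℓ * (c a q.1 * d b q.2) else 0‖ₑ)]
    refine ENNReal.tsum_le_tsum fun ℓ => ?_
    rw [ENNReal.tsum_prod (f := fun (j k : ℤ) => ‖if ℓ + j + k = m then
      ∑ a, ∑ b, X a b ℓ * (c a j * d b k) else 0‖ₑ)]
    refine ENNReal.tsum_le_tsum fun j => ?_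
    rw [tsum_eq_single (m - ℓ - j)]
    · rw [if_pos (by ring)]
    · intro k hk
      rw [if_neg (by intro h; apply hk; omega), enorm_zero]
  · intro θ
    have hn : ∀ f : ℤ → ℂ, Summable (fun n => ‖f n‖) →
        Summable (fun n => ‖f n * Complex.exp (Complex.I * (n : ℂ) * (θ : ℂ))‖) := by
      intro f hf; simpa only [norm_mul, norm_exp_I, mul_one] using hf
    rw [hF]
    simp only [Finset.sum_mul]
    have hs2 : ∀ a b, Summable (fun p : ℤ × ℤ × ℤ => X a b p.1 * (c a p.2.1 * d b p.2.2) *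
        Complex.exp (Complex.I * ((p.1 + p.2.1 + p.2.2 : ℤ) : ℂ) * (θ : ℂ))) := by
      intro a b
      apply Summable.of_norm
      have := hs1 a b
      simpa only [norm_mul, norm_exp_I, mul_one] using this
    rw [Summable.tsum_finsetSum (fun a _ => summable_sum fun b _ => hs2 a b)]
    refine Finset.sum_congr rfl fun a _ => ?_
    rw [Summable.tsum_finsetSum (fun b _ => hs2 a b)]
    refine Finset.sum_congr rfl fun b _ => ?_
    rw [mul_assoc, tsum_mul_tsum_of_summable_norm (hn _ (hc a)) (hn _ (hd b)),
      tsum_mul_tsum_of_summable_norm (hn _ (hX a b)) ((hn _ (hc a)).mul_norm (hn _ (hd b)))]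
    congr 1; ext p
    have : Complex.exp (Complex.I * ((p.1 + p.2.1 + p.2.2 : ℤ) : ℂ) * (θ : ℂ)) =
      Complex.exp (Complex.I * (p.1 : ℂ) * (θ : ℂ)) * Complex.exp (Complex.I * (p.2.1 : ℂ) * (θ : ℂ))
       * Complex.exp (Complex.I * (p.2.2 : ℂ) * (θ : ℂ)) := by
      rw [← Complex.exp_add, ← Complex.exp_add]; congr 1; push_cast; ring
    rw [this]; ring

lemma coef_eq (x : ℤ → ℂ) (hx : Summable (fun n => ‖x n‖))
    (h : ∀ θ : ℝ, ∑' n : ℤ, x n * Complex.exp (Complex.I * (n : ℂ) * (θ : ℂ)) = 0) (n : ℤ) :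
    x n = 0 := by
  have h1 := fourierCoef_tsum x id hx (fun _ => 0) (fun θ => (h θ).symm) n
  simp only [id, fourierCoef, zero_mul, intervalIntegral.integral_zero, mul_zero] at h1
  rw [tsum_ite_eq] at h1
  exact h1.symm

lemma coef_null (A : ℝ → Matrix (Fin 2) (Fin 2) ℂ) (X : Fin 2 → Fin 2 → ℤ → ℂ)
    (hX : ∀ a b, Summable (fun n => ‖X a b n‖))
    (hA : ∀ (θ : ℝ) (a b : Fin 2),
        A θ a b = ∑' ℓ : ℤ, X a b ℓ * Complex.exp (Complex.I * (ℓ : ℂ) * (θ : ℂ)))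
    (hN : ∀ θ : ℝ, ∀ ξ : Fin 2 → ℂ, ξ 0 ^ 2 + ξ 1 ^ 2 = 0 →
        ∑ a : Fin 2, ∑ b : Fin 2, ξ a * A θ a b * ξ b = 0) (n : ℤ) :
    X 0 0 n = X 1 1 n ∧ X 1 0 n = - X 0 1 n := by
  have hs : ∀ a b (θ : ℝ), Summable (fun ℓ : ℤ => X a b ℓ * Complex.exp (Complex.I * (ℓ : ℂ) * (θ : ℂ))) := by
    intro a b θ
    apply Summable.of_norm
    simpa only [norm_mul, norm_exp_I, mul_one] using hX a b
  have hp : ∀ θ, A θ 0 0 - A θ 1 1 = 0 ∧ A θ 1 0 + A θ 0 1 = 0 := by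
    intro θ
    have h1 := hN θ ![1, Complex.I] (by simp)
    have h2 := hN θ ![1, -Complex.I] (by simp)
    simp only [Fin.sum_univ_two, Matrix.cons_val_zero, Matrix.cons_val_one] at h1 h2
    have e := Complex.I_mul_I
    refine ⟨by linear_combination (h1 + h2)/2 - A θ 1 1 * e, ?_⟩
    linear_combination (-Complex.I) * (h1 - h2)/2 + (A θ 1 0 + A θ 0 1) * e
  constructor
  · have := coef_eq (fun n => X 0 0 n - X 1 1 n) (((hX 0 0).of_norm.sub (hX 1 1).of_norm).norm) ?_ n
    · exact sub_eq_zero.mp this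
    · intro θ
      simp only [sub_mul]
      rw [(hs 0 0 θ).tsum_sub (hs 1 1 θ), ← hA, ← hA]
      exact (hp θ).1
  · have := coef_eq (fun n => X 1 0 n + X 0 1 n) (((hX 1 0).of_norm.add (hX 0 1).of_norm).norm) ?_ n
    · exact eq_neg_of_add_eq_zero_left this
    · intro θ
      simp only [add_mul]
      rw [(hs 1 0 θ).tsum_add (hs 0 1 θ), ← hA, ← hA]
      exact (hp θ).2

lemma four_sq (y : Fin 2 → Fin 2 → ENNReal) :
    (∑ a, ∑ b, y a b)^2 ≤ 4 * ∑ a, ∑ b, (y a b)^2 := by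
  have := cs_tsum (fun _ : Fin 2 × Fin 2 => (1:ENNReal)) (fun p => y p.1 p.2)
  simp only [tsum_fintype, Fintype.sum_prod_type, one_mul, one_pow, Fin.sum_univ_two] at this ⊢
  refine this.trans (le_of_eq ?_)
  norm_num

lemma summable_of_mul (α : ℤ → ℂ) (h : Summable (fun j : ℤ => ‖(j:ℂ) * α j‖)) :
    Summable (fun j => ‖α j‖) := by
  refine Summable.of_norm_bounded_eventually h ?_
  have : {j : ℤ | ¬ ‖‖α j‖‖ ≤ ‖(j:ℂ) * α j‖} ⊆ {0} := by
    intro j hj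
    by_contra h0
    apply hj
    rw [norm_norm, norm_mul, Complex.norm_intCast]
    have : (1:ℝ) ≤ |(j:ℝ)| := by exact_mod_cast Int.one_le_abs h0
    exact le_mul_of_one_le_left (norm_nonneg _) this
  exact (Set.finite_singleton 0).subset this

lemma ofReal_eq_om' (s t : ℝ) (n : ℤ) (z : ℂ) :
    ENNReal.ofReal ((1 + (n : ℝ) ^ 2) ^ (s - 1) * Real.exp (2 * |(n : ℝ)| * t) * ‖z‖ ^ 2) =
      (om s n * (ENNReal.ofReal (Real.exp (|(n:ℝ)| * t)) * ‖z‖ₑ))^2 := by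
  have : Real.exp (2 * |(n : ℝ)| * t) = Real.exp (|(n:ℝ)| * t) ^ 2 := by
    rw [← Real.exp_nat_mul]; congr 1; push_cast; ring
  rw [mul_pow, mul_pow, om_sq, this, ENNReal.ofReal_mul (by positivity),
    ENNReal.ofReal_mul (by positivity), ENNReal.ofReal_pow (by positivity),
    ENNReal.ofReal_pow (by positivity), ofReal_norm, mul_assoc]

lemma main_est (s : ℝ) (hs : 3 / 2 < s) (t : ℝ) (ht : 0 ≤ t) (α β : ℤ → ℂ)
    (A : ℝ → Matrix (Fin 2) (Fin 2) ℂ) (X : Fin 2 → Fin 2 → ℤ → ℂ)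
    (hα : ∑' j : ℤ, (om s j * ‖(j : ℂ) * α j‖ₑ)^2 ≠ ⊤)
    (hβ : ∑' j : ℤ, (om s j * ‖(j : ℂ) * β j‖ₑ)^2 ≠ ⊤)
    (hA : ∀ (θ : ℝ) (a b : Fin 2),
        A θ a b = ∑' ℓ : ℤ, X a b ℓ * Complex.exp (Complex.I * (ℓ : ℂ) * (θ : ℂ)))
    (N : ENNReal) (hNt : N ≠ ⊤)
    (hN : ∀ a b, ∑' n : ℤ, (om s n * (ENNReal.ofReal (Real.exp (|(n:ℝ)| * t)) * ‖X a b n‖ₑ))^2 ≤ N)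
    (hnull : ∀ θ : ℝ, ∀ ξ : Fin 2 → ℂ, ξ 0 ^ 2 + ξ 1 ^ 2 = 0 →
        ∑ a : Fin 2, ∑ b : Fin 2, ξ a * A θ a b * ξ b = 0) :
    ∑' m : ℤ, (om s m * (ENNReal.ofReal (Real.exp (|(m:ℝ)| * t)) *
        ‖fourierCoef (nullForm A α β t) m‖ₑ))^2 ≤
      (ENNReal.ofReal (Real.exp (-2 * t)))^2 * (CC s * (16 * N) * (CC s *
        (∑' j : ℤ, (om s j * ‖(j : ℂ) * α j‖ₑ)^2) * (∑' j : ℤ, (om s j * ‖(j : ℂ) * β j‖ₑ)^2))) := by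
  have a1 := summable_of_wt s hs _ hα
  have b1 := summable_of_wt s hs _ hβ
  have a0 := summable_of_mul α a1
  have b0 := summable_of_mul β b1
  have hX : ∀ a b, Summable (fun n => ‖X a b n‖) := by
    intro a b
    apply summable_of_wt s hs
    refine ne_top_of_le_ne_top hNt (le_trans (ENNReal.tsum_le_tsum fun n => ?_) (hN a b))
    gcongr
    refine le_mul_of_one_le_left zero_le ?_
    rw [ENNReal.one_le_ofReal, Real.one_le_exp_iff]
    positivity
  obtain ⟨c, hc1, hc2, hc3⟩ := deriv_tau α a0 a1 t ht
  obtain ⟨d, hd1, hd2, hd3⟩ := deriv_tau β b0 b1 t ht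
  let c' : Fin 2 → ℤ → ℂ := fun a j => if a = 0 then c j else
    Complex.I * j * α j * (Real.exp (-|(j:ℝ)| * t) : ℝ)
  let d' : Fin 2 → ℤ → ℂ := fun a j => if a = 0 then d j else
    Complex.I * j * β j * (Real.exp (-|(j:ℝ)| * t) : ℝ)
  have hle : ∀ j : ℤ, Real.exp (-|(j:ℝ)| * t) ≤ 1 := fun j => by
    rw [Real.exp_le_one_iff]; have := abs_nonneg (j:ℝ); nlinarith
  have hn : ∀ (j : ℤ) (z : ℂ), ‖Complex.I * j * z * (Real.exp (-|(j:ℝ)| * t) : ℝ)‖ ≤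
      ‖(j:ℂ) * z‖ * Real.exp (-|(j:ℝ)| * t) := by
    intro j z
    rw [norm_mul, Complex.norm_real, Real.norm_of_nonneg (Real.exp_pos _).le, mul_assoc Complex.I,
      norm_mul Complex.I, Complex.norm_I, one_mul]
  have hc' : ∀ a j, ‖c' a j‖ ≤ ‖(j:ℂ) * α j‖ * Real.exp (-|(j:ℝ)| * t) := by
    intro a j
    by_cases h : a = 0
    · simpa only [c', h, if_true] using hc1 j
    · simpa only [c', h, if_false] using hn j (α j)
  have hd' : ∀ a j, ‖d' a j‖ ≤ ‖(j:ℂ) * β j‖ * Real.exp (-|(j:ℝ)| * t) := by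
    intro a j
    by_cases h : a = 0
    · simpa only [d', h, if_true] using hd1 j
    · simpa only [d', h, if_false] using hn j (β j)
  have hcs : ∀ a, Summable (fun j => ‖c' a j‖) := fun a =>
    Summable.of_nonneg_of_le (fun _ => norm_nonneg _)
      (fun j => (hc' a j).trans (mul_le_of_le_one_right (norm_nonneg _) (hle j))) a1
  have hds : ∀ a, Summable (fun j => ‖d' a j‖) := fun a =>
    Summable.of_nonneg_of_le (fun _ => norm_nonneg _)
      (fun j => (hd' a j).trans (mul_le_of_le_one_right (norm_nonneg _) (hle j))) b1
  have hcd : ∀ a θ, pderivCyl a (linSol α) t θ =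
      ∑' n : ℤ, c' a n * Complex.exp (Complex.I * (n : ℂ) * (θ : ℂ)) := by
    intro a θ
    fin_cases a
    · exact hc3 θ
    · exact deriv_theta α a0 a1 t ht θ
  have hdd : ∀ a θ, pderivCyl a (linSol β) t θ =
      ∑' n : ℤ, d' a n * Complex.exp (Complex.I * (n : ℂ) * (θ : ℂ)) := by
    intro a θ
    fin_cases a
    · exact hd3 θ
    · exact deriv_theta β b0 b1 t ht θ
  have hexp := triple_expand X c' d' hX hcs hds (nullForm A α β t) (by
    intro θ
    simp only [nullForm, hcd, hdd, hA])
  set P : ℤ → ENNReal := fun n => ENNReal.ofReal (Real.exp (|(n:ℝ)| * t)) * ∑ a, ∑ b, ‖X a b n‖ₑ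
    with hP
  set f : ℤ → ENNReal := fun j => ‖(j : ℂ) * α j‖ₑ with hf
  set g : ℤ → ENNReal := fun j => ‖(j : ℂ) * β j‖ₑ with hg
  set e := ENNReal.ofReal (Real.exp (-2 * t)) with he
  have hk : ∀ ℓ j k : ℤ, ENNReal.ofReal (Real.exp (|((ℓ + j + k : ℤ):ℝ)| * t)) *
      ‖∑ a, ∑ b, X a b ℓ * (c' a j * d' b k)‖ₑ ≤ e * (P ℓ * (f j * g k)) := by
    intro ℓ j k
    have hnn := coef_null A X hX hA hnull ℓ
    have := kernel_bound t ht ℓ j k (α j) (β k) (fun a b => X a b ℓ) (fun a => c' a j)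
      (fun a => d' a k) hnn.1 hnn.2 (fun a => hc' a j) (fun a => hd' a k)
      (fun h => hc2 h j) (fun h => hd2 h k) rfl rfl
    have := ENNReal.ofReal_le_ofReal this
    rw [mul_comm, ENNReal.ofReal_mul (by positivity), ofReal_norm,
      ENNReal.ofReal_mul (by positivity), ENNReal.ofReal_mul (by positivity),
      ENNReal.ofReal_mul (by positivity), ENNReal.ofReal_mul (by positivity), ofReal_norm,
      ofReal_norm] at this
    refine this.trans (le_of_eq ?_)
    rw [ENNReal.ofReal_sum_of_nonneg (fun _ _ => by positivity)]
    simp only [ENNReal.ofReal_sum_of_nonneg (fun _ _ => norm_nonneg _), ofReal_norm, hP, hf, hg, he]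
  have hm : ∀ m : ℤ, (om s m * (ENNReal.ofReal (Real.exp (|(m:ℝ)| * t)) *
        ‖fourierCoef (nullForm A α β t) m‖ₑ))^2 ≤
      e^2 * (om s m * ∑' ℓ, P ℓ * (∑' j, f j * g (m - ℓ - j)))^2 := by
    intro m
    rw [← mul_pow, ← mul_assoc e, mul_comm e, mul_assoc (om s m)]
    refine pow_le_pow_left' (mul_le_mul_right ?_ _) 2
    refine (mul_le_mul_right (hexp m) _).trans ?_
    rw [← ENNReal.tsum_mul_left, ← ENNReal.tsum_mul_left]
    refine ENNReal.tsum_le_tsum fun ℓ => ?_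
    rw [← ENNReal.tsum_mul_left, ← ENNReal.tsum_mul_left, ← ENNReal.tsum_mul_left]
    refine ENNReal.tsum_le_tsum fun j => ?_
    have := hk ℓ j (m - ℓ - j)
    rwa [show ℓ + j + (m - ℓ - j) = m by ring] at this
  refine (ENNReal.tsum_le_tsum hm).trans ?_
  rw [ENNReal.tsum_mul_left]
  gcongr
  refine (conv_est s hs P (fun n => ∑' j, f j * g (n - j))).trans ?_
  have hPN : ∑' j, (om s j * P j)^2 ≤ 16 * N := by
    have h1 : ∀ n, (om s n * P n)^2 ≤ 4 * ∑ a, ∑ b,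
        (om s n * (ENNReal.ofReal (Real.exp (|(n:ℝ)| * t)) * ‖X a b n‖ₑ))^2 := by
      intro n
      refine le_trans (le_of_eq ?_) (four_sq _)
      simp only [hP, Finset.mul_sum]
    refine (ENNReal.tsum_le_tsum h1).trans ?_
    rw [ENNReal.tsum_mul_left]
    simp only [Fin.sum_univ_two]
    rw [ENNReal.tsum_add, ENNReal.tsum_add, ENNReal.tsum_add]
    calc _ ≤ 4 * ((N + N) + (N + N)) := by gcongr <;> apply hN
      _ = _ := by ring
  gcongr
  exact conv_est s hs f g


theorem stmt4 (s : ℝ) (hs : 3 / 2 < s) :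
    ∃ C : ℝ, 0 < C ∧
    ∀ t : ℝ, 0 ≤ t →
    ∀ (α β : ℤ → ℂ) (A : ℝ → Matrix (Fin 2) (Fin 2) ℂ) (Ahat : Fin 2 → Fin 2 → ℤ → ℂ),
      (∑' j : ℤ, ENNReal.ofReal
          ((1 + (j : ℝ) ^ 2) ^ (s - 1) * ‖(j : ℂ) * α j‖ ^ 2) ≠ ⊤) →
      (∑' k : ℤ, ENNReal.ofReal
          ((1 + (k : ℝ) ^ 2) ^ (s - 1) * ‖(k : ℂ) * β k‖ ^ 2) ≠ ⊤) →
      (∀ (θ : ℝ) (a b : Fin 2),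
        A θ a b = ∑' ℓ : ℤ, Ahat a b ℓ * Complex.exp (Complex.I * (ℓ : ℂ) * (θ : ℂ))) →
      ((⨆ (a : Fin 2) (b : Fin 2), ∑' ℓ : ℤ, ENNReal.ofReal
          ((1 + (ℓ : ℝ) ^ 2) ^ (s - 1) * Real.exp (2 * |(ℓ : ℝ)| * t) * ‖Ahat a b ℓ‖ ^ 2))
          ≠ ⊤) →
      (∀ θ : ℝ, ∀ ξ : Fin 2 → ℂ, ξ 0 ^ 2 + ξ 1 ^ 2 = 0 →
        ∑ a : Fin 2, ∑ b : Fin 2, ξ a * A θ a b * ξ b = 0) →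
      ∑' m : ℤ, ENNReal.ofReal
          ((1 + (m : ℝ) ^ 2) ^ (s - 1) * Real.exp (2 * |(m : ℝ)| * t) *
            ‖fourierCoef (nullForm A α β t) m‖ ^ 2)
        ≤ ENNReal.ofReal (C ^ 2 * Real.exp (-4 * t)) *
          (⨆ (a : Fin 2) (b : Fin 2), ∑' ℓ : ℤ, ENNReal.ofReal
            ((1 + (ℓ : ℝ) ^ 2) ^ (s - 1) * Real.exp (2 * |(ℓ : ℝ)| * t) * ‖Ahat a b ℓ‖ ^ 2)) *
          (∑' j : ℤ, ENNReal.ofReal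
            ((1 + (j : ℝ) ^ 2) ^ (s - 1) * ‖(j : ℂ) * α j‖ ^ 2)) *
          (∑' k : ℤ, ENNReal.ofReal
            ((1 + (k : ℝ) ^ 2) ^ (s - 1) * ‖(k : ℂ) * β k‖ ^ 2)) := by
  refine ⟨4 * (CC s).toReal + 1, by positivity, ?_⟩
  intro t ht α β A X hα hβ hA hN hnull
  simp only [ofReal_eq_om, ofReal_eq_om'] at hα hβ hN ⊢
  set N := ⨆ (a : Fin 2) (b : Fin 2), ∑' ℓ : ℤ,
    (om s ℓ * (ENNReal.ofReal (Real.exp (|(ℓ:ℝ)| * t)) * ‖X a b ℓ‖ₑ))^2 with hNdef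
  refine (main_est s hs t ht α β A X hα hβ hA N hN
    (fun a b => le_iSup₂_of_le (f := fun (a b : Fin 2) => ∑' ℓ : ℤ,
    (om s ℓ * (ENNReal.ofReal (Real.exp (|(ℓ:ℝ)| * t)) * ‖X a b ℓ‖ₑ))^2) a b le_rfl) hnull).trans ?_
  have h1 : ENNReal.ofReal (Real.exp (-2 * t))^2 * (16 * (CC s)^2) ≤
      ENNReal.ofReal ((4 * (CC s).toReal + 1)^2 * Real.exp (-4 * t)) := by
    rw [← ENNReal.ofReal_toReal (CC_ne_top s hs), ENNReal.toReal_ofReal ENNReal.toReal_nonneg]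
    have h16 : (16:ENNReal) = ENNReal.ofReal 16 := by simp
    have hc : 0 ≤ (CC s).toReal := ENNReal.toReal_nonneg
    rw [h16, ← ENNReal.ofReal_pow (by positivity), ← ENNReal.ofReal_pow (by positivity),
      ← ENNReal.ofReal_mul (by positivity), ← ENNReal.ofReal_mul (by positivity)]
    apply ENNReal.ofReal_le_ofReal
    have e1 : Real.exp (-4 * t) = Real.exp (-2 * t)^2 := by
      rw [← Real.exp_nat_mul]; congr 1; push_cast; ring
    rw [e1, mul_comm]
    gcongr
    nlinarith
  calc _ = ENNReal.ofReal (Real.exp (-2 * t))^2 * (16 * (CC s)^2) * N *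
        (∑' j : ℤ, (om s j * ‖(j : ℂ) * α j‖ₑ)^2) * (∑' j : ℤ, (om s j * ‖(j : ℂ) * β j‖ₑ)^2) := by
        ring
    _ ≤ _ := by gcongr
end

section
/- Let d ≥ 2. There exists a constant C > 0, depending only on d, such that for every integer m ≥ 1, every harmonic homogeneous polynomial H of degree m on ℝ^d, and every coordinate index i ∈ {1,…,d}, the restriction of the partial derivative ∂_i H to the unit sphere satisfies ‖(∂_i H)|_{S^{d−1}}‖_{L²(S^{d−1})} ≤ C ⟨m⟩ ‖H|_{S^{d−1}}‖_{L²(S^{d−1})}. -/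
open MeasureTheory MvPolynomial

/-- Evaluation of a polynomial on `ℝ^d` at a point of the unit sphere. -/
noncomputable def sphereEval {d : ℕ} (p : MvPolynomial (Fin d) ℝ)
    (y : Metric.sphere (0 : EuclideanSpace ℝ (Fin d)) 1) : ℝ :=
  MvPolynomial.eval (fun i => (y : EuclideanSpace ℝ (Fin d)) i) p

/-- `p` is a harmonic polynomial, homogeneous of degree `k`, on `ℝ^d`. -/
def IsHarmHom (d : ℕ) (p : MvPolynomial (Fin d) ℝ) (k : ℕ) : Prop :=
  p.IsHomogeneous k ∧ ∑ i : Fin d, pderiv i (pderiv i p) = 0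

/-- The surface measure on the unit sphere of `ℝ^d`. -/
noncomputable def sphereMeasure (d : ℕ) :
    Measure (Metric.sphere (0 : EuclideanSpace ℝ (Fin d)) 1) :=
  (volume : Measure (EuclideanSpace ℝ (Fin d))).toSphere

/-- The `L²(S^{d-1})` norm of the restriction of a polynomial to the unit sphere. -/
noncomputable def sphL2Norm (d : ℕ) (p : MvPolynomial (Fin d) ℝ) : ℝ :=
  Real.sqrt (∫ y : Metric.sphere (0 : EuclideanSpace ℝ (Fin d)) 1,
    (sphereEval p y) ^ 2 ∂(sphereMeasure d))

local notation "E" d => EuclideanSpace ℝ (Fin d)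

lemma eval_smul_hom {d n : ℕ} {p : MvPolynomial (Fin d) ℝ} (hp : p.IsHomogeneous n)
    (r : ℝ) (x : Fin d → ℝ) : eval (fun i => r * x i) p = r ^ n * eval x p := by
  rw [eval_eq, eval_eq, Finset.mul_sum]
  refine Finset.sum_congr rfl fun s hs => ?_
  have h : ∑ i ∈ s.support, s i = n := by
    have := hp.degree_eq_sum_deg_support hs
    simpa [Finsupp.degree] using this.symm
  simp_rw [mul_pow]
  rw [Finset.prod_mul_distrib, Finset.prod_pow_eq_pow_sum, h]
  ring

lemma cont_eval {d : ℕ} (p : MvPolynomial (Fin d) ℝ) :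
    Continuous (fun x : E d => eval (fun i => x i) p) :=
  (MvPolynomial.continuous_eval p).comp (by fun_prop)

lemma cont_sphereEval {d : ℕ} (p : MvPolynomial (Fin d) ℝ) : Continuous (sphereEval p) :=
  (cont_eval p).comp continuous_subtype_val

lemma integrable_sphereEval {d : ℕ} (p : MvPolynomial (Fin d) ℝ) :
    Integrable (sphereEval p) (sphereMeasure d) := by
  have : IsFiniteMeasure (sphereMeasure d) := by unfold sphereMeasure; infer_instance
  exact (cont_sphereEval p).integrable_of_hasCompactSupport (HasCompactSupport.of_compactSpace _)

lemma lineDeriv_poly {d : ℕ} (i : Fin d) (p : MvPolynomial (Fin d) ℝ) (x : E d) :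
    HasLineDerivAt ℝ (fun x : E d => eval (fun j => x j) p)
      (eval (fun j => x j) (pderiv i p)) x (EuclideanSpace.single i 1) := by
  unfold HasLineDerivAt
  induction p using MvPolynomial.induction_on with
  | C a => simpa using hasDerivAt_const (0 : ℝ) a
  | add p q hp hq =>
    simp only [map_add]
    exact hp.add hq
  | mul_X p j hp =>
    have hx : HasDerivAt (fun t : ℝ => (x + t • EuclideanSpace.single i (1 : ℝ) : E d) j)
        (eval (fun j => x j) (pderiv i (X j))) 0 := by
      by_cases h : j = i
      · subst h
        simpa using (hasDerivAt_id (0 : ℝ)).const_add (x j)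
      · simpa [h, pderiv_X, Pi.single_apply] using hasDerivAt_const (0 : ℝ) (x j)
    have := hp.mul hx
    simp only [map_mul, eval_X, Derivation.leibniz, map_add, smul_eq_mul]
    refine HasDerivAt.congr_deriv this ?_
    simp only [zero_smul, add_zero]
    ring

lemma lineDeriv_gauss {d : ℕ} (i : Fin d) (x : E d) :
    HasLineDerivAt ℝ (fun x : E d => Real.exp (-‖x‖ ^ 2))
      (-(2 * x i * Real.exp (-‖x‖ ^ 2))) x (EuclideanSpace.single i 1) := by
  have h := ((hasStrictFDerivAt_norm_sq x).hasFDerivAt.neg.exp).hasLineDerivAt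
    (EuclideanSpace.single i 1)
  have e : inner ℝ x (EuclideanSpace.single i (1:ℝ)) = x i := by
    simp [EuclideanSpace.inner_single_right]
  refine HasDerivAt.congr_deriv h ?_
  simp [e]
  ring

lemma poly_bound {d n : ℕ} {p : MvPolynomial (Fin d) ℝ} (hp : p.IsHomogeneous n) :
    ∃ K : ℝ, ∀ x : E d, |eval (fun i => x i) p| ≤ K * ‖x‖ ^ n := by
  obtain ⟨K, hK⟩ := (isCompact_closedBall (0 : E d) 1).exists_bound_of_continuousOn
    (cont_eval p).continuousOn
  refine ⟨K, fun x => ?_⟩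
  by_cases hx : x = 0
  · subst hx
    have h1 := eval_smul_hom hp 0 (fun _ => 0)
    have h2 := hK 0 (by simp)
    simp only [zero_mul, PiLp.zero_apply, norm_zero, Real.norm_eq_abs] at *
    rw [h1, abs_mul, mul_comm, abs_of_nonneg (by positivity : (0:ℝ) ≤ 0 ^ n)]
    exact mul_le_mul_of_nonneg_right h2 (by positivity)
  · have hx' : ‖x‖ ≠ 0 := by simpa using hx
    have h1 := eval_smul_hom hp ‖x‖ (fun i => (‖x‖⁻¹ • x) i)
    have h2 := hK (‖x‖⁻¹ • x) (by simp [norm_smul, hx'])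
    have h3 : (fun i => ‖x‖ * (‖x‖⁻¹ • x) i) = fun i => x i := by
      funext i; simp [hx']
    rw [h3] at h1
    rw [h1, abs_mul, mul_comm, abs_of_nonneg (by positivity : (0:ℝ) ≤ ‖x‖ ^ n)]
    exact mul_le_mul_of_nonneg_right h2 (by positivity)

lemma radial_integrable (k : ℕ) :
    IntegrableOn (fun r : ℝ => r ^ k * Real.exp (-r ^ 2)) (Set.Ioi 0) := by
  have h := integrableOn_rpow_mul_exp_neg_mul_sq (b := 1) one_pos (s := k)
    (by have : (0:ℝ) ≤ k := by positivity
        linarith)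
  simpa using h

lemma gauss_integrable {d n : ℕ} (hd : 2 ≤ d) {p : MvPolynomial (Fin d) ℝ}
    (hp : p.IsHomogeneous n) :
    Integrable (fun x : E d => eval (fun i => x i) p * Real.exp (-‖x‖ ^ 2)) := by
  obtain ⟨K, hK⟩ := poly_bound hp
  have : Nonempty (Fin d) := ⟨⟨0, by omega⟩⟩
  have h1 : Integrable (fun x : E d => (fun r : ℝ => K * (r ^ n * Real.exp (-r ^ 2))) ‖x‖) := by
    refine (integrable_fun_norm_addHaar (volume : Measure (E d))
      (f := fun r : ℝ => K * (r ^ n * Real.exp (-r ^ 2)))).2 ?_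
    refine IntegrableOn.congr_fun (f := fun r : ℝ => K * (r ^ (d - 1 + n) * Real.exp (-r ^ 2)))
      ((radial_integrable (d - 1 + n)).const_mul K) ?_ measurableSet_Ioi
    intro r _
    simp [pow_add]
    ring
  refine h1.mono' ?_ (Filter.Eventually.of_forall fun x => ?_)
  · exact ((cont_eval p).mul (by fun_prop)).aestronglyMeasurable
  · rw [norm_mul, Real.norm_eq_abs, Real.norm_eq_abs, Real.abs_exp]
    have := mul_le_mul_of_nonneg_right (hK x) (Real.exp_pos (-‖x‖ ^ 2)).le
    simpa [mul_assoc] using this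

noncomputable def radI (k : ℕ) : ℝ := ∫ r in Set.Ioi (0:ℝ), r ^ k * Real.exp (-r ^ 2)

lemma radI_eq (k : ℕ) : radI k = 1 / 2 * Real.Gamma (((k : ℝ) + 1) / 2) := by
  have h := integral_rpow_mul_exp_neg_rpow (p := 2) (q := k) two_pos
    (by have : (0:ℝ) ≤ k := by positivity
        linarith)
  simpa [radI] using h

lemma radI_pos (k : ℕ) : 0 < radI k := by
  rw [radI_eq]
  have := Real.Gamma_pos_of_pos (s := ((k : ℝ) + 1) / 2) (by positivity)
  positivity

lemma radI_succ (k : ℕ) : radI (k + 2) = ((k : ℝ) + 1) / 2 * radI k := by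
  rw [radI_eq, radI_eq]
  have h : (((k + 2 : ℕ) : ℝ) + 1) / 2 = ((k : ℝ) + 1) / 2 + 1 := by push_cast; ring
  rw [h, Real.Gamma_add_one (by positivity)]
  ring

lemma polar {d n : ℕ} {p : MvPolynomial (Fin d) ℝ} (hd : 2 ≤ d)
    (hp : p.IsHomogeneous n) :
    ∫ x : E d, eval (fun i => x i) p * Real.exp (-‖x‖ ^ 2)
      = (∫ y, sphereEval p y ∂(sphereMeasure d)) * radI (d - 1 + n) := by
  have : Nonempty (Fin d) := ⟨⟨0, by omega⟩⟩
  set F : (E d) → ℝ := fun x => eval (fun i => x i) p * Real.exp (-‖x‖ ^ 2) with hF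
  calc ∫ x, F x = ∫ x : ({(0 : E d)}ᶜ : Set (E d)), F x.1
          ∂((volume : Measure (E d)).comap (↑)) := by
        rw [integral_subtype_comap (measurableSet_singleton _).compl F,
          restrict_compl_singleton]
    _ = ∫ z : (Metric.sphere (0 : E d) 1) × (Set.Ioi (0:ℝ)),
          sphereEval p z.1 * ((z.2 : ℝ) ^ n * Real.exp (-(z.2 : ℝ) ^ 2))
          ∂((volume : Measure (E d)).toSphere.prod
            (.volumeIoiPow (Module.finrank ℝ (E d) - 1))) := by
        rw [← ((volume : Measure (E d)).measurePreserving_homeomorphUnitSphereProd).integral_comp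
          (Homeomorph.measurableEmbedding _)]
        refine integral_congr_ae (Filter.Eventually.of_forall fun x => ?_)
        have hx' : ‖x.1‖ ≠ 0 := norm_ne_zero_iff.2 x.2
        have h1 := eval_smul_hom hp ‖x.1‖ (fun i => (‖x.1‖⁻¹ • x.1) i)
        have h3 : (fun i => ‖x.1‖ * (‖x.1‖⁻¹ • x.1) i) = fun i => x.1 i := by
          funext i; simp [hx']
        rw [h3] at h1
        simp only [hF, sphereEval, homeomorphUnitSphereProd_apply_snd_coe,
          homeomorphUnitSphereProd_apply_fst_coe]
        rw [h1]
        ring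
    _ = (∫ y, sphereEval p y ∂(sphereMeasure d)) *
          ∫ r : Set.Ioi (0:ℝ), ((r : ℝ) ^ n * Real.exp (-(r : ℝ) ^ 2))
            ∂(Measure.volumeIoiPow (Module.finrank ℝ (E d) - 1)) := by
        rw [sphereMeasure]
        exact integral_prod_mul (sphereEval p)
          (fun r : Set.Ioi (0:ℝ) => ((r : ℝ) ^ n * Real.exp (-(r : ℝ) ^ 2)))
    _ = _ := by
        congr 1
        simp only [Measure.volumeIoiPow, ENNReal.ofReal]
        rw [integral_withDensity_eq_integral_smul,
          integral_subtype_comap measurableSet_Ioi fun a : ℝ ↦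
            Real.toNNReal (a ^ (Module.finrank ℝ (E d) - 1)) • (a ^ n * Real.exp (-a ^ 2)),
          radI]
        · refine setIntegral_congr_fun measurableSet_Ioi fun x hx => ?_
          simp only [NNReal.smul_def]
          rw [Real.coe_toNNReal _ (pow_nonneg (le_of_lt hx) _)]
          simp [pow_add]
          ring
        · exact (measurable_subtype_coe.pow_const _).real_toNNReal

lemma ibp {d k : ℕ} (hd : 2 ≤ d) {q : MvPolynomial (Fin d) ℝ}
    (hq : q.IsHomogeneous (k + 1)) (i : Fin d) :
    ∫ y, sphereEval (pderiv i q) y ∂(sphereMeasure d)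
      = ((k : ℝ) + d) * ∫ y, sphereEval (q * X i) y ∂(sphereMeasure d) := by
  have h1 : (pderiv i q).IsHomogeneous k := by simpa using hq.pderiv (i := i)
  have h2 : (q * X i).IsHomogeneous (k + 2) := by simpa using hq.mul (isHomogeneous_X ℝ i)
  have hE : ∀ x : E d, eval (fun j => x j) q * -(2 * x i * Real.exp (-‖x‖ ^ 2))
      = -2 * (eval (fun j => x j) (q * X i) * Real.exp (-‖x‖ ^ 2)) := by
    intro x; simp; ring
  have key := integral_bilinear_hasLineDerivAt_right_eq_neg_left_of_integrable
    (μ := (volume : Measure (E d))) (B := ContinuousLinearMap.mul ℝ ℝ)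
    (f := fun x : E d => eval (fun j => x j) q)
    (f' := fun x : E d => eval (fun j => x j) (pderiv i q))
    (g := fun x : E d => Real.exp (-‖x‖ ^ 2))
    (g' := fun x : E d => -(2 * x i * Real.exp (-‖x‖ ^ 2)))
    (v := EuclideanSpace.single i 1)
    (by simpa using gauss_integrable hd h1)
    (by simp only [ContinuousLinearMap.mul_apply', hE]
        exact (gauss_integrable hd h2).const_mul _)
    (by simpa using gauss_integrable hd hq)
    (fun x _ => lineDeriv_poly i q x) (fun x _ => lineDeriv_gauss i x)
  simp only [ContinuousLinearMap.mul_apply', hE] at key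
  rw [integral_const_mul, polar hd h1, polar hd h2, ← add_assoc, radI_succ] at key
  have hpos := radI_pos (d - 1 + k)
  have hc : ((d - 1 + k : ℕ) : ℝ) + 1 = k + d := by
    have : d - 1 + k + 1 = k + d := by omega
    exact_mod_cast this
  rw [hc] at key
  apply mul_right_cancel₀ hpos.ne'
  linarith

lemma main_id {d m : ℕ} (hd : 2 ≤ d) (hm : 1 ≤ m) {H : MvPolynomial (Fin d) ℝ}
    (hH : IsHarmHom d H m) :
    ∑ i, ∫ y, (sphereEval (pderiv i H) y) ^ 2 ∂(sphereMeasure d)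
      = (2 * (m : ℝ) - 2 + d) * m * ∫ y, (sphereEval H y) ^ 2 ∂(sphereMeasure d) := by
  obtain ⟨k, rfl⟩ : ∃ k, m = k + 1 := ⟨m - 1, by omega⟩
  have hq : ∀ i, (H * pderiv i H).IsHomogeneous (2 * k + 1) := fun i => by
    have := hH.1.mul (hH.1.pderiv (i := i))
    convert this using 1
    simp; ring
  have h := Finset.sum_congr rfl (fun i (_ : i ∈ Finset.univ) => ibp hd (hq i) i)
  rw [← Finset.mul_sum, ← integral_finsetSum _ (fun i _ => integrable_sphereEval _),
    ← integral_finsetSum _ (fun i _ => integrable_sphereEval _)] at h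
  rw [← integral_finsetSum]
  · have e1 : ∀ y, ∑ i, sphereEval (pderiv i (H * pderiv i H)) y
        = ∑ i, (sphereEval (pderiv i H) y) ^ 2 := by
      intro y
      have h0 := congrArg (fun p => sphereEval p y) hH.2
      simp only [sphereEval, map_sum, map_zero] at h0
      simp only [sphereEval, Derivation.leibniz, map_add, smul_eq_mul, map_mul]
      rw [Finset.sum_add_distrib, ← Finset.mul_sum, h0]
      simp [sq]
    have e2 : ∀ y, ∑ i, sphereEval (H * pderiv i H * X i) y
        = ((k + 1 : ℕ) : ℝ) * (sphereEval H y) ^ 2 := by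
      intro y
      have h0 := congrArg (fun p => sphereEval p y) hH.1.sum_X_mul_pderiv
      simp only [sphereEval, map_sum, map_mul, nsmul_eq_mul, map_natCast] at h0
      simp only [sphereEval, map_mul]
      rw [sq, mul_left_comm]
      rw [← h0, Finset.mul_sum]
      refine Finset.sum_congr rfl fun i _ => ?_
      ring
    simp only [e1, e2] at h
    rw [h, integral_const_mul]
    push_cast
    ring
  · intro i _
    have := integrable_sphereEval (pderiv i H ^ 2)
    have e : sphereEval (pderiv i H ^ 2) = fun y => (sphereEval (pderiv i H) y) ^ 2 := by
      funext y; simp [sphereEval]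
    rwa [e] at this

theorem stmt6 (d : ℕ) (hd : 2 ≤ d) :
    ∃ C : ℝ, 0 < C ∧
      ∀ (m : ℕ), 1 ≤ m →
      ∀ H : MvPolynomial (Fin d) ℝ, IsHarmHom d H m →
      ∀ i : Fin d,
        sphL2Norm d (pderiv i H) ≤ C * Real.sqrt (1 + (m : ℝ) ^ 2) * sphL2Norm d H := by
  refine ⟨Real.sqrt (d + 2), by positivity, fun m hm H hH i => ?_⟩
  unfold sphL2Norm
  rw [← Real.sqrt_mul (by positivity), ← Real.sqrt_mul (by positivity)]
  apply Real.sqrt_le_sqrt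
  have h1 : ∫ y, (sphereEval (pderiv i H) y) ^ 2 ∂(sphereMeasure d)
      ≤ ∑ i, ∫ y, (sphereEval (pderiv i H) y) ^ 2 ∂(sphereMeasure d) :=
    Finset.single_le_sum (f := fun i => ∫ y, (sphereEval (pderiv i H) y) ^ 2 ∂(sphereMeasure d))
      (fun j _ => integral_nonneg fun y => sq_nonneg _) (Finset.mem_univ i)
  rw [main_id hd hm hH] at h1
  refine h1.trans (mul_le_mul_of_nonneg_right ?_ (integral_nonneg fun y => sq_nonneg _))
  have hm' : (1 : ℝ) ≤ m := by exact_mod_cast hm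
  have hd' : (2 : ℝ) ≤ d := by exact_mod_cast hd
  nlinarith [mul_nonneg (by linarith : (0:ℝ) ≤ d) (mul_nonneg (by linarith : (0:ℝ) ≤ m) (by linarith : (0:ℝ) ≤ (m:ℝ) - 1))]
end

section
/- Let d ≥ 2 and let u : ℝ^d → ℝ be infinitely differentiable on the open unit ball B(0,1) and satisfy Δu(x) = f(u(x)) for every x ∈ B(0,1), where f : ℝ → ℝ is real-analytic on an open interval containing the range u(B(0,1)) and f(0) = 0. Then there exist r₀ ∈ (0,1), a function u_L : B(0,r₀) → ℝ with Δu_L = 0 on B(0,r₀), and a real-analytic function g on B(0,r₀), such that u(x) = u_L(x) + ‖x‖² g(x) for all x ∈ B(0,r₀). -/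
open MeasureTheory

/-- The Laplacian `Δu(x) = Σᵢ ∂²u/∂xᵢ²(x)` of a function on `ℝ^d`, computed via iterated
Fréchet derivatives in the coordinate directions. -/
noncomputable def lap (d : ℕ) (u : EuclideanSpace ℝ (Fin d) → ℝ)
    (x : EuclideanSpace ℝ (Fin d)) : ℝ :=
  ∑ i : Fin d,
    fderiv ℝ (fun y => fderiv ℝ u y (EuclideanSpace.single i 1)) x (EuclideanSpace.single i 1)

open scoped ContDiff Topology
open Filter

/-- necessary second-order condition -/
lemma aux_second_nonneg {h h' : ℝ → ℝ} {c : ℝ} (h1 : ∀ t, HasDerivAt h (h' t) t)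
    (h2 : HasDerivAt h' c 0) (hmin : IsLocalMin h 0) : 0 ≤ c := by
  by_contra hc
  push Not at hc
  have e1 : deriv h = h' := funext fun t => (h1 t).deriv
  have e2 : deriv (deriv h) 0 = c := by rw [e1]; exact h2.deriv
  have hmax : IsLocalMax h 0 :=
    isLocalMax_of_deriv_deriv_neg (by rw [e2]; exact hc) hmin.deriv_eq_zero (h1 0).continuousAt
  have hconst : h =ᶠ[𝓝 0] fun _ => h 0 := by
    filter_upwards [hmin, hmax] with t ha hb
    exact le_antisymm hb ha
  have h3 : deriv h =ᶠ[𝓝 0] deriv (fun _ => h 0) := hconst.deriv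
  have h4 := h3.deriv_eq
  rw [e2] at h4
  simp at h4
  linarith

/-- first and second derivative along lines -/
lemma aux_line {d : ℕ} {w : EuclideanSpace ℝ (Fin d) → ℝ} (hw : ContDiff ℝ 2 w)
    (p v : EuclideanSpace ℝ (Fin d)) :
    (∀ t : ℝ, HasDerivAt (fun t : ℝ => w (p + t • v)) (fderiv ℝ w (p + t • v) v) t) ∧
    HasDerivAt (fun t : ℝ => fderiv ℝ w (p + t • v) v) (fderiv ℝ (fderiv ℝ w) p v v) 0 := by
  have hl : ∀ t : ℝ, HasDerivAt (fun t : ℝ => p + t • v) v t := fun t => by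
    simpa using ((hasDerivAt_id t).smul_const v).const_add p
  constructor
  · intro t
    exact ((hw.differentiable (by norm_num)) _).hasFDerivAt.comp_hasDerivAt t (hl t)
  · have h1 : ContDiff ℝ 1 (fderiv ℝ w) := hw.fderiv_right (by norm_num)
    have h2 : HasDerivAt (fun t : ℝ => fderiv ℝ w (p + t • v))
        (fderiv ℝ (fderiv ℝ w) (p + (0:ℝ) • v) v) 0 :=
      ((h1.differentiable (by norm_num)) _).hasFDerivAt.comp_hasDerivAt (0:ℝ) (hl 0)
    have h3 := h2.clm_apply (hasDerivAt_const (0:ℝ) v)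
    simpa using h3

/-- Gradient estimate in a coordinate direction, by the maximum principle. -/
lemma aux_grad {d : ℕ} {w : EuclideanSpace ℝ (Fin d) → ℝ} (hw : ContDiff ℝ 2 w)
    (x : EuclideanSpace ℝ (Fin d)) {δ M N : ℝ} (hδ : 0 < δ)
    (hM : ∀ y, ‖y - x‖ ≤ δ → |w y| ≤ M)
    (hN : ∀ y, ‖y - x‖ ≤ δ → |∑ j : Fin d, fderiv ℝ (fderiv ℝ w) y (EuclideanSpace.single j 1)
      (EuclideanSpace.single j 1)| < N) (i : Fin d) :
    |fderiv ℝ w x (EuclideanSpace.single i 1)| ≤ d * M / δ + N * δ / 2 := by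
  set e : Fin d → EuclideanSpace ℝ (Fin d) := fun j => EuclideanSpace.single j 1 with he
  set σ : EuclideanSpace ℝ (Fin d) → EuclideanSpace ℝ (Fin d) := fun z => z - (2 * z i) • e i with hσ
  set α := M / δ ^ 2 with hα
  set γ := d * α + N / 2 with hγ
  have hM0 : 0 ≤ M := (abs_nonneg _).trans (hM x (by simpa using hδ.le))
  have hN0 : 0 < N := (abs_nonneg _).trans_lt (hN x (by simpa using hδ.le))
  have hα0 : 0 ≤ α := by positivity
  have hγ0 : 0 ≤ γ := by positivity
  have hei : ∀ j k, e j k = if k = j then 1 else 0 := by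
    intro j k; simp [he, Pi.single_apply]
  have hee : ∀ j, ‖e j‖ = 1 := by intro j; simp [he]
  have hinn : ∀ (z : EuclideanSpace ℝ (Fin d)) j, inner ℝ z (e j) = z j := by
    intro z j; simp [he, EuclideanSpace.inner_single_right]
  have hσn : ∀ z, ‖σ z‖ = ‖z‖ := by
    intro z
    have : ‖σ z‖ ^ 2 = ‖z‖ ^ 2 := by
      simp only [hσ]
      rw [norm_sub_sq_real, inner_smul_right, norm_smul, hee, hinn, mul_one, Real.norm_eq_abs, sq_abs]
      ring
    exact (pow_left_inj₀ (norm_nonneg _) (norm_nonneg _) two_ne_zero).1 this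
  have hσc : Continuous σ := by simp only [hσ]; fun_prop
  -- key: for s = ±1
  have key : ∀ s : ℝ, |s| = 1 → ∀ z : EuclideanSpace ℝ (Fin d), ‖z‖ ≤ δ → 0 ≤ z i →
      0 ≤ α * ‖z‖ ^ 2 + γ * δ * z i - γ * (z i) ^ 2 + s / 2 * (w (x + z) - w (x + σ z)) := by
    intro s hs
    set Φ : EuclideanSpace ℝ (Fin d) → ℝ := fun z =>
      α * ‖z‖ ^ 2 + γ * δ * z i - γ * (z i) ^ 2 + s / 2 * (w (x + z) - w (x + σ z)) with hΦ
    set K : Set (EuclideanSpace ℝ (Fin d)) := Metric.closedBall 0 δ ∩ {z | 0 ≤ z i} with hK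
    have hKc : IsCompact K := (isCompact_closedBall 0 δ).inter_right
      (isClosed_le continuous_const (by fun_prop))
    have hΦc : Continuous Φ := by
      have := hw.continuous
      simp only [hΦ]; fun_prop
    have hKne : K.Nonempty := ⟨0, by simp [hK, hδ.le]⟩
    obtain ⟨z0, hz0K, hz0⟩ := hKc.exists_isMinOn hKne hΦc.continuousOn
    suffices h : 0 ≤ Φ z0 by
      intro z hz hzi
      exact h.trans (hz0 ⟨by simpa using hz, hzi⟩)
    by_contra hneg
    push Not at hneg
    have hz0n : ‖z0‖ ≤ δ := by simpa using hz0K.1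
    have hz0i : 0 ≤ z0 i := hz0K.2
    have hb : ∀ z : EuclideanSpace ℝ (Fin d), ‖z‖ ≤ δ → |s / 2 * (w (x + z) - w (x + σ z))| ≤ M := by
      intro z hz
      have h1 := hM (x + z) (by simpa using hz)
      have h2 := hM (x + σ z) (by simpa [hσn] using hz)
      rw [abs_mul, abs_div, hs]
      have := abs_sub (w (x + z)) (w (x + σ z))
      norm_num
      linarith
    have hipos : 0 < z0 i := by
      rcases hz0i.lt_or_eq with h | h
      · exact h
      · exfalso
        have hs0 : σ z0 = z0 := by simp [hσ, ← h]
        have : Φ z0 = α * ‖z0‖ ^ 2 := by simp [hΦ, hs0, ← h]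
        have : 0 ≤ Φ z0 := by rw [this]; positivity
        linarith
    have hile : ∀ z : EuclideanSpace ℝ (Fin d), z i ≤ ‖z‖ := fun z => by
      have := PiLp.norm_apply_le z i
      exact (le_abs_self _).trans this
    have hnlt : ‖z0‖ < δ := by
      rcases hz0n.lt_or_eq with h | h
      · exact h
      · exfalso
        have h1 := neg_le_of_abs_le (hb z0 hz0n)
        have h2 : α * ‖z0‖ ^ 2 = M := by rw [h, hα]; field_simp
        have h3 : 0 ≤ γ * z0 i * (δ - z0 i) :=
          mul_nonneg (mul_nonneg hγ0 hz0i) (by have := hile z0; linarith)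
        have : 0 ≤ Φ z0 := by simp only [hΦ]; nlinarith
        linarith
    have hloc : IsLocalMin Φ z0 := by
      have : K ∈ 𝓝 z0 := by
        have h1 : Metric.ball (0 : EuclideanSpace ℝ (Fin d)) δ ∩ {z | 0 < z i} ∈ 𝓝 z0 := by
          refine IsOpen.mem_nhds (Metric.isOpen_ball.inter (isOpen_lt continuous_const (by fun_prop))) ?_
          exact ⟨by simpa using hnlt, hipos⟩
        filter_upwards [h1] with z hz
        exact ⟨Metric.ball_subset_closedBall hz.1, le_of_lt (show 0 < z i from hz.2)⟩
      exact hz0.isLocalMin this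
    have hσσ : ∀ j (t : ℝ), σ (z0 + t • e j) = σ z0 + t • σ (e j) := by
      intro j t
      simp only [hσ, PiLp.add_apply, PiLp.smul_apply, smul_eq_mul]
      module
    have hD : ∀ j, 0 ≤ 2 * α - (if i = j then 2 * γ else 0) +
        s / 2 * (fderiv ℝ (fderiv ℝ w) (x + z0) (e j) (e j) -
          fderiv ℝ (fderiv ℝ w) (x + σ z0) (e j) (e j)) := by
      intro j
      obtain ⟨A1, A2⟩ := aux_line hw (x + z0) (e j)
      obtain ⟨B1, B2⟩ := aux_line hw (x + σ z0) (σ (e j))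
      have hσe : fderiv ℝ (fderiv ℝ w) (x + σ z0) (σ (e j)) (σ (e j)) =
          fderiv ℝ (fderiv ℝ w) (x + σ z0) (e j) (e j) := by
        by_cases hij : i = j
        · subst hij
          have : σ (e i) = - e i := by simp only [hσ, hei]; norm_num; module
          rw [this]; simp
        · have : σ (e j) = e j := by simp [hσ, hei, hij]
          rw [this]
      rw [← hσe]
      set ei : ℝ := if i = j then 1 else 0 with hei'
      have hnq : ∀ t : ℝ, Φ (z0 + t • e j) = α * (‖z0‖ ^ 2 + 2 * t * z0 j + t ^ 2) +
          γ * δ * (z0 i + t * ei) - γ * (z0 i + t * ei) ^ 2 +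
          s / 2 * (w (x + z0 + t • e j) - w (x + σ z0 + t • σ (e j))) := by
        intro t
        have hh : (z0 + t • e j) i = z0 i + t * ei := by
          simp [hei, hei']
        simp only [hΦ, hσσ]
        rw [hh, norm_add_sq_real, inner_smul_right, norm_smul, hee, hinn, mul_one,
          Real.norm_eq_abs, sq_abs, add_assoc x z0, add_assoc x (σ z0)]
        ring
      have hmin : IsLocalMin (fun t : ℝ => Φ (z0 + t • e j)) 0 := by
        have hc : ContinuousAt (fun t : ℝ => z0 + t • e j) 0 := by fun_prop
        have h0 : z0 + (0:ℝ) • e j = z0 := by simp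
        have : Tendsto (fun t : ℝ => z0 + t • e j) (𝓝 0) (𝓝 z0) := by
          have := hc.tendsto; rwa [h0] at this
        have h2 := this.eventually hloc
        filter_upwards [h2] with t ht
        simpa [h0] using ht
      have hlin : ∀ t : ℝ, HasDerivAt (fun t : ℝ => z0 i + t * ei) ei t := fun t => by
        simpa using ((hasDerivAt_id t).mul_const ei).const_add (z0 i)
      have hsq : ∀ t : ℝ, HasDerivAt (fun t : ℝ => ‖z0‖ ^ 2 + 2 * t * z0 j + t ^ 2)
          (2 * z0 j + 2 * t) t := fun t => by
        have h1 := (((hasDerivAt_id t).const_mul 2).mul_const (z0 j)).const_add (‖z0‖ ^ 2)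
        have h2 := h1.fun_add ((hasDerivAt_id t).fun_pow 2)
        simpa using h2
      have hfin := aux_second_nonneg (h := fun t : ℝ => Φ (z0 + t • e j))
        (h' := fun t => α * (2 * z0 j + 2 * t) + γ * δ * ei - γ * (2 * (z0 i + t * ei) * ei) +
          s / 2 * (fderiv ℝ w (x + z0 + t • e j) (e j) -
            fderiv ℝ w (x + σ z0 + t • σ (e j)) (σ (e j))))
        (c := α * 2 - γ * (2 * ei * ei) + s / 2 * (fderiv ℝ (fderiv ℝ w) (x + z0) (e j) (e j) -
          fderiv ℝ (fderiv ℝ w) (x + σ z0) (σ (e j)) (σ (e j)))) ?_ ?_ hmin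
      · have : γ * (2 * ei * ei) = if i = j then 2 * γ else 0 := by
          simp only [hei']; split_ifs <;> ring
        linarith
      · intro t
        simp only [hnq]
        have h1 := ((((hsq t).const_mul α).fun_add ((hlin t).const_mul (γ * δ))).fun_sub
          (((hlin t).fun_pow 2).const_mul γ)).fun_add (((A1 t).fun_sub (B1 t)).const_mul (s / 2))
        simpa using h1
      · have h0 : HasDerivAt (fun t : ℝ => 2 * z0 j + 2 * t) 2 0 := by
          simpa using ((hasDerivAt_id (0:ℝ)).const_mul 2).const_add (2 * z0 j)
        have h1 := (((h0.const_mul α).add_const (γ * δ * ei)).fun_sub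
          ((((hlin 0).const_mul 2).mul_const ei).const_mul γ)).fun_add ((A2.fun_sub B2).const_mul (s / 2))
        simpa using h1
    have hsum := Finset.sum_nonneg (s := Finset.univ) (fun j _ => hD j)
    rw [Finset.sum_add_distrib, Finset.sum_sub_distrib, ← Finset.mul_sum Finset.univ _ (s / 2),
      Finset.sum_sub_distrib] at hsum
    simp only [Finset.sum_const, Finset.card_univ, Fintype.card_fin, nsmul_eq_mul,
      Finset.sum_ite_eq, Finset.mem_univ, if_true] at hsum
    have h1 := hN (x + z0) (by simpa using hz0n)
    have h2 := hN (x + σ z0) (by simpa [hσn] using hz0n)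
    set P := ∑ j : Fin d, fderiv ℝ (fderiv ℝ w) (x + z0) (e j) (e j)
    set Q := ∑ j : Fin d, fderiv ℝ (fderiv ℝ w) (x + σ z0) (e j) (e j)
    have h3 : s / 2 * (P - Q) < N := by
      refine (le_abs_self _).trans_lt ?_
      rw [abs_mul, abs_div, hs]
      have := abs_sub P Q
      norm_num
      linarith
    have : 2 * γ = 2 * d * α + N := by rw [hγ]; ring
    linarith
  -- conclude
  have hβ : d * M / δ + N * δ / 2 = γ * δ := by
    rw [hγ, hα]; field_simp
  rw [hβ]
  have hlim : Tendsto (fun t : ℝ => t⁻¹ * (1 / 2 * (w (x + t • e i) - w (x + t • (-e i))))) (𝓝[>] 0)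
      (𝓝 (fderiv ℝ w x (e i))) := by
    have A1 := (aux_line hw x (e i)).1 0
    have B1 := (aux_line hw x (-e i)).1 0
    have h1 := (A1.sub B1).const_mul (1 / 2)
    have h2 := h1.tendsto_slope_zero_right
    simp only [zero_add, zero_smul, add_zero, smul_eq_mul, map_neg, Pi.sub_apply] at h2
    convert h2 using 2
    · ring
    · ring
  have hev : ∀ᶠ t : ℝ in 𝓝[>] 0, |t⁻¹ * (1 / 2 * (w (x + t • e i) - w (x + t • (-e i))))| ≤
      α * t + γ * δ := by
    have : Set.Ioo (0:ℝ) δ ∈ 𝓝[>] (0:ℝ) := Ioo_mem_nhdsGT hδ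
    filter_upwards [this] with t ht
    have hn : ‖t • e i‖ = t := by rw [norm_smul, hee, mul_one, Real.norm_eq_abs, abs_of_pos ht.1]
    have hti : (t • e i) i = t := by simp [hei]
    have hst : σ (t • e i) = t • (-e i) := by
      simp only [hσ, hti]; module
    have k1 := key 1 (by simp) (t • e i) (by rw [hn]; exact ht.2.le) (by rw [hti]; exact ht.1.le)
    have k2 := key (-1) (by simp) (t • e i) (by rw [hn]; exact ht.2.le) (by rw [hti]; exact ht.1.le)
    rw [hn, hti, hst] at k1 k2
    rw [abs_mul, abs_inv, abs_of_pos ht.1, inv_mul_le_iff₀ ht.1, abs_le]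
    have : 0 ≤ γ * t ^ 2 := by positivity
    constructor <;> nlinarith
  have hlim2 : Tendsto (fun t : ℝ => α * t + γ * δ) (𝓝[>] 0) (𝓝 (γ * δ)) := by
    have : Continuous (fun t : ℝ => α * t + γ * δ) := by fun_prop
    have := (this.tendsto 0).mono_left (nhdsWithin_le_nhds (s := Set.Ioi 0))
    simpa using this
  exact le_of_tendsto_of_tendsto hlim.abs hlim2 hev

open scoped ContDiff Topology
open Filter MeasureTheory


/-- vector valued Laplacian -/
noncomputable def VL {d : ℕ} {G : Type} [NormedAddCommGroup G] [NormedSpace ℝ G]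
    (u : EuclideanSpace ℝ (Fin d) → G) (x : EuclideanSpace ℝ (Fin d)) : G :=
  ∑ i : Fin d,
    fderiv ℝ (fun y => fderiv ℝ u y (EuclideanSpace.single i 1)) x (EuclideanSpace.single i 1)

section
variable {d : ℕ} {G : Type} [NormedAddCommGroup G] [NormedSpace ℝ G]

lemma VL_eq {u : EuclideanSpace ℝ (Fin d) → G} {x : EuclideanSpace ℝ (Fin d)}
    (hu : DifferentiableAt ℝ (fderiv ℝ u) x) :
    VL u x = ∑ i : Fin d, fderiv ℝ (fderiv ℝ u) x (EuclideanSpace.single i 1)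
      (EuclideanSpace.single i 1) := by
  unfold VL
  refine Finset.sum_congr rfl fun i _ => ?_
  rw [fderiv_clm_apply hu (by fun_prop)]
  simp

lemma cd_fderiv {u : EuclideanSpace ℝ (Fin d) → G} (hu : ContDiff ℝ ∞ u) :
    ContDiff ℝ ∞ (fderiv ℝ u) := hu.fderiv_right (by simp)

lemma cd_diff {u : EuclideanSpace ℝ (Fin d) → G} (hu : ContDiff ℝ ∞ u) :
    Differentiable ℝ u := hu.differentiable (by simp)

lemma VL_eq' {u : EuclideanSpace ℝ (Fin d) → G} (hu : ContDiff ℝ ∞ u) :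
    VL u = fun x => ∑ i : Fin d, fderiv ℝ (fderiv ℝ u) x (EuclideanSpace.single i 1)
      (EuclideanSpace.single i 1) :=
  funext fun x => VL_eq (cd_diff (cd_fderiv hu) x)

lemma VL_smooth {u : EuclideanSpace ℝ (Fin d) → G} (hu : ContDiff ℝ ∞ u) :
    ContDiff ℝ ∞ (VL u) := by
  rw [VL_eq' hu]
  have := cd_fderiv (cd_fderiv hu)
  refine ContDiff.sum fun i _ => ?_
  exact (this.clm_apply contDiff_const).clm_apply contDiff_const

lemma snd_symm {u : EuclideanSpace ℝ (Fin d) → G} (hu : ContDiff ℝ ∞ u)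
    (x v w : EuclideanSpace ℝ (Fin d)) :
    fderiv ℝ (fderiv ℝ u) x v w = fderiv ℝ (fderiv ℝ u) x w v :=
  second_derivative_symmetric (fun y => (cd_diff hu y).hasFDerivAt)
    (cd_diff (cd_fderiv hu) x).hasFDerivAt v w

lemma VL_fderiv {u : EuclideanSpace ℝ (Fin d) → G} (hu : ContDiff ℝ ∞ u) :
    VL (fderiv ℝ u) = fderiv ℝ (VL u) := by
  have h1 := cd_fderiv hu
  have h2 := cd_fderiv h1
  have h3 := cd_fderiv h2
  have hd2 := cd_diff h2
  have hap : ∀ (a b x v : EuclideanSpace ℝ (Fin d)),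
      HasFDerivAt (fun y => fderiv ℝ (fderiv ℝ u) y a b)
        (((fderiv ℝ (fderiv ℝ (fderiv ℝ u)) x).flip a).flip b) x := by
    intro a b x v
    have e1 := ((hd2 x).hasFDerivAt.clm_apply (hasFDerivAt_const a x)).clm_apply (hasFDerivAt_const b x)
    refine e1.congr_fderiv ?_
    ext v
    simp
  ext x v
  rw [VL_eq' h1, VL_eq' hu]
  have e2 : HasFDerivAt (fun x => ∑ i : Fin d, fderiv ℝ (fderiv ℝ u) x (EuclideanSpace.single i 1)
      (EuclideanSpace.single i 1)) (∑ i : Fin d, ((fderiv ℝ (fderiv ℝ (fderiv ℝ u)) x).flip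
        (EuclideanSpace.single i 1)).flip (EuclideanSpace.single i 1)) x :=
    HasFDerivAt.fun_sum fun i _ => hap _ _ x v
  rw [e2.fderiv]
  simp only [sum_apply, ContinuousLinearMap.flip_apply]
  refine Finset.sum_congr rfl fun i _ => ?_
  set a : EuclideanSpace ℝ (Fin d) := EuclideanSpace.single i 1
  rw [snd_symm h1 x v a]
  have e3 : (fun y => fderiv ℝ (fderiv ℝ u) y a v) = fun y => fderiv ℝ (fderiv ℝ u) y v a :=
    funext fun y => snd_symm hu y a v
  have e4 := (hap a v x v).fderiv
  rw [e3, (hap v a x v).fderiv] at e4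
  have := congrArg (fun L => L a) e4
  simpa using this.symm

lemma grad_vec {u : EuclideanSpace ℝ (Fin d) → G} (hu : ContDiff ℝ ∞ u)
    (x : EuclideanSpace ℝ (Fin d)) {δ M N : ℝ} (hδ : 0 < δ)
    (hM : ∀ y, ‖y - x‖ ≤ δ → ‖u y‖ ≤ M) (hN : ∀ y, ‖y - x‖ ≤ δ → ‖VL u y‖ < N) :
    ‖fderiv ℝ u x‖ ≤ d * (d * M / δ + N * δ / 2) := by
  have hM0 : 0 ≤ M := (norm_nonneg _).trans (hM x (by simpa using hδ.le))
  have hN0 : 0 < N := (norm_nonneg _).trans_lt (hN x (by simpa using hδ.le))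
  set B := d * M / δ + N * δ / 2 with hB
  have hB0 : 0 ≤ B := by positivity
  have hcoord : ∀ i : Fin d, ‖fderiv ℝ u x (EuclideanSpace.single i 1)‖ ≤ B := by
    intro i
    obtain ⟨l, hl1, hl2⟩ := exists_dual_vector'' ℝ (fderiv ℝ u x (EuclideanSpace.single i 1))
    have hlb : ∀ z, |l z| ≤ ‖z‖ := fun z => by
      have := l.le_opNorm z
      rw [Real.norm_eq_abs] at this
      exact this.trans (mul_le_of_le_one_left (norm_nonneg _) hl1)
    have f1 : fderiv ℝ (fun y => l (u y)) = fun y => l.comp (fderiv ℝ u y) := by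
      funext y
      exact (l.hasFDerivAt.comp y (cd_diff hu y).hasFDerivAt).fderiv
    have f2 : ∀ y v w, fderiv ℝ (fderiv ℝ (fun y => l (u y))) y v w =
        l (fderiv ℝ (fderiv ℝ u) y v w) := by
      intro y v w
      rw [f1]
      have := ((ContinuousLinearMap.compL ℝ (EuclideanSpace ℝ (Fin d)) G ℝ l).hasFDerivAt.comp y
        (cd_diff (cd_fderiv hu) y).hasFDerivAt).fderiv
      have e : (fun y => l.comp (fderiv ℝ u y)) =
        (⇑(ContinuousLinearMap.compL ℝ (EuclideanSpace ℝ (Fin d)) G ℝ l)) ∘ fderiv ℝ u := by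
          funext y; simp
      rw [e, this]; simp
    have hg := aux_grad (w := fun y => l (u y)) (l.contDiff.comp (by exact_mod_cast contDiff_infty.1 hu 2)) x hδ (M := M)
      (N := N) (fun y hy => (hlb _).trans (hM y hy)) (fun y hy => by
        simp only [f2]
        rw [← map_sum, ← VL_eq (cd_diff (cd_fderiv hu) y)]
        exact (hlb _).trans_lt (hN y hy)) i
    rw [f1] at hg
    simp only [ContinuousLinearMap.comp_apply] at hg
    rw [hl2] at hg
    simpa using hg
  refine ContinuousLinearMap.opNorm_le_bound _ (by positivity) fun v => ?_
  have hv : v = ∑ i : Fin d, v i • EuclideanSpace.single i (1:ℝ) := by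
    ext j; simp [Finset.sum_apply, Pi.single_apply]
  calc ‖fderiv ℝ u x v‖ = ‖∑ i : Fin d, v i • fderiv ℝ u x (EuclideanSpace.single i 1)‖ := by
        conv_lhs => rw [hv]
        simp only [map_sum, map_smul]
    _ ≤ ∑ i : Fin d, ‖v‖ * B := by
        refine norm_sum_le_of_le _ fun i _ => ?_
        rw [norm_smul]
        exact mul_le_mul (PiLp.norm_apply_le v i) (hcoord i) (norm_nonneg _) (norm_nonneg _)
    _ = d * B * ‖v‖ := by simp; ring

end

lemma grad_high {d : ℕ} (x : EuclideanSpace ℝ (Fin d)) {δ M N : ℝ} (hδ : 0 < δ) (k : ℕ) :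
    ∀ {G : Type} [NormedAddCommGroup G] [NormedSpace ℝ G]
    {u : EuclideanSpace ℝ (Fin d) → G} (_ : ContDiff ℝ ∞ u)
    (_ : ∀ y, ‖y - x‖ ≤ δ → ‖iteratedFDeriv ℝ k u y‖ ≤ M)
    (_ : ∀ y, ‖y - x‖ ≤ δ → ‖iteratedFDeriv ℝ k (VL u) y‖ < N),
    ‖iteratedFDeriv ℝ (k + 1) u x‖ ≤ d * (d * M / δ + N * δ / 2) := by
  induction k with
  | zero =>
    intro G _ _ u hu hM hN
    rw [← norm_iteratedFDeriv_fderiv, norm_iteratedFDeriv_zero]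
    exact grad_vec hu x hδ (fun y hy => by simpa using hM y hy) (fun y hy => by simpa using hN y hy)
  | succ k ih =>
    intro G _ _ u hu hM hN
    rw [← norm_iteratedFDeriv_fderiv]
    refine ih (cd_fderiv hu) (fun y hy => ?_) (fun y hy => ?_)
    · rw [norm_iteratedFDeriv_fderiv]; exact hM y hy
    · rw [VL_fderiv hu, norm_iteratedFDeriv_fderiv]; exact hN y hy


/-- weights -/
noncomputable def wt (k : ℕ) : ℝ := 1 / ((k : ℝ) + 1) ^ 2

lemma wt_pos (k : ℕ) : 0 < wt k := by unfold wt; positivity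

lemma wt_sum (n : ℕ) : ∑ i ∈ Finset.range (n + 1), wt i ≤ 2 - 1 / ((n : ℝ) + 1) := by
  induction n with
  | zero => simp [wt]; norm_num
  | succ n ih =>
    rw [Finset.sum_range_succ]
    have : wt (n + 1) ≤ 1 / ((n : ℝ) + 1) - 1 / ((n : ℝ) + 1 + 1) := by
      unfold wt
      push_cast
      rw [div_sub_div _ _ (by positivity) (by positivity), div_le_div_iff₀ (by positivity) (by positivity)]
      have : (0:ℝ) ≤ n := n.cast_nonneg
      nlinarith
    push_cast
    linarith

lemma wt_conv (n : ℕ) : ∑ i ∈ Finset.range (n + 1), wt i * wt (n - i) ≤ 8 * wt n := by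
  have h1 : ∀ i ∈ Finset.range (n + 1), wt i * wt (n - i) ≤ 2 * wt n * (wt i + wt (n - i)) := by
    intro i hi
    have hi' : i ≤ n := Nat.lt_succ_iff.1 (Finset.mem_range.1 hi)
    obtain ⟨m, rfl⟩ := Nat.exists_eq_add_of_le hi'
    simp only [Nat.add_sub_cancel_left]
    unfold wt
    push_cast
    set a : ℝ := (i : ℝ) + 1
    have ha : (1:ℝ) ≤ a := by simp [a]
    set b : ℝ := (m : ℝ) + 1
    have hb : (1:ℝ) ≤ b := by simp [b]
    have hab : (i : ℝ) + m + 1 = a + b - 1 := by simp [a, b]; ring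
    rw [hab]
    have e1 : 1 / a ^ 2 * (1 / b ^ 2) = 1 / (a * b) ^ 2 := by field_simp
    have e2 : 2 * (1 / (a + b - 1) ^ 2) * (1 / a ^ 2 + 1 / b ^ 2) =
        2 * (a ^ 2 + b ^ 2) / ((a + b - 1) ^ 2 * (a * b) ^ 2) := by
      have : a + b - 1 ≠ 0 := by linarith
      field_simp
      ring
    rw [e1, e2]
    have hp : 0 < a * b := by positivity
    have hq : 0 < a + b - 1 := by linarith
    rw [div_le_div_iff₀ (by positivity) (by positivity)]
    have : (a + b - 1) ^ 2 ≤ 2 * (a ^ 2 + b ^ 2) := by nlinarith [sq_nonneg (a - b)]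
    nlinarith [mul_le_mul_of_nonneg_right this (sq_nonneg (a * b))]
  have h2 := wt_sum n
  have h3 : ∑ i ∈ Finset.range (n + 1), wt (n - i) = ∑ i ∈ Finset.range (n + 1), wt i := by
    have := Finset.sum_range_reflect (fun i => wt i) (n + 1)
    simpa using this
  have h4 : (0:ℝ) ≤ 1 / ((n : ℝ) + 1) := by positivity
  calc _ ≤ ∑ i ∈ Finset.range (n + 1), 2 * wt n * (wt i + wt (n - i)) := Finset.sum_le_sum h1
    _ = 2 * wt n * (2 * ∑ i ∈ Finset.range (n + 1), wt i) := by
      rw [← Finset.mul_sum, Finset.sum_add_distrib, h3]; ring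
    _ ≤ 2 * wt n * (2 * 2) := by
      have := wt_pos n
      gcongr
      linarith
    _ = 8 * wt n := by ring

lemma pow_bound {d : ℕ} {v : EuclideanSpace ℝ (Fin d) → ℝ} (hv : ContDiff ℝ ∞ v)
    (x : EuclideanSpace ℝ (Fin d)) {ε B : ℝ} (hε : 0 ≤ ε) (hB : 0 ≤ B) {n : ℕ}
    (h : ∀ j ≤ n, ‖iteratedFDeriv ℝ j v x‖ ≤ ε * B ^ j * j.factorial * wt j) (m : ℕ) :
    ∀ j ≤ n, ‖iteratedFDeriv ℝ j (fun y => v y ^ (m + 1)) x‖ ≤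
      ε * (8 * ε) ^ m * B ^ j * j.factorial * wt j := by
  induction m with
  | zero => intro j hj; simpa using h j hj
  | succ m ih =>
    intro j hj
    have e : (fun y => v y ^ (m + 1 + 1)) = fun y => v y ^ (m + 1) * v y := by
      funext y; rw [pow_succ]
    rw [e]
    have hvp : ContDiff ℝ ∞ (fun y => v y ^ (m + 1)) := hv.pow _
    refine (norm_iteratedFDeriv_mul_le hvp hv x (n := j) (by exact_mod_cast le_top)).trans ?_
    calc _ ≤ ∑ i ∈ Finset.range (j + 1), (ε * (8 * ε) ^ m * ε * B ^ j * j.factorial) * (wt i * wt (j - i)) := by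
          refine Finset.sum_le_sum fun i hi => ?_
          have hi' : i ≤ j := Nat.lt_succ_iff.1 (Finset.mem_range.1 hi)
          have h1 := ih i (hi'.trans hj)
          have h2 := h (j - i) ((Nat.sub_le _ _).trans hj)
          have w1 := (wt_pos i).le
          have w2 := (wt_pos (j - i)).le
          calc _ ≤ (j.choose i : ℝ) * (ε * (8 * ε) ^ m * B ^ i * i.factorial * wt i) *
                (ε * B ^ (j - i) * (j - i).factorial * wt (j - i)) := by gcongr
            _ = (ε * (8 * ε) ^ m * ε * (B ^ i * B ^ (j - i)) *
                  ((j.choose i : ℝ) * i.factorial * (j - i).factorial)) * (wt i * wt (j - i)) := by ring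
            _ = _ := by
                rw [← pow_add, Nat.add_sub_cancel' hi']
                have := Nat.choose_mul_factorial_mul_factorial hi'
                have h' : (j.choose i : ℝ) * i.factorial * (j - i).factorial = j.factorial := by
                  exact_mod_cast this
                rw [h']
      _ = (ε * (8 * ε) ^ m * ε * B ^ j * j.factorial) * ∑ i ∈ Finset.range (j + 1), (wt i * wt (j - i)) := by
          rw [Finset.mul_sum]
      _ ≤ (ε * (8 * ε) ^ m * ε * B ^ j * j.factorial) * (8 * wt j) := by
          have := wt_conv j
          gcongr
      _ = _ := by ring

lemma iteratedDeriv_taylor (i : ℕ) : ∀ (F : ℝ → ℝ) (n : ℕ) (s0 : ℝ),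
    iteratedDeriv i (taylorWithinEval F (n + i) Set.univ s0) =
      taylorWithinEval (iteratedDeriv i F) n Set.univ s0 := by
  induction i with
  | zero => intro F n s0; simp
  | succ i ih =>
    intro F n s0
    rw [iteratedDeriv_succ', iteratedDeriv_succ', ← ih]
    congr 1
    funext x
    have := (hasDerivAt_taylorWithinEval_succ (x₀ := s0) (x := x) (s := Set.univ) F (n + i)).deriv
    rw [derivWithin_univ] at this
    exact this

lemma comp_bound {d : ℕ} {U : EuclideanSpace ℝ (Fin d) → ℝ} (hU : ContDiff ℝ ∞ U)
    (x : EuclideanSpace ℝ (Fin d)) {F : ℝ → ℝ} {t : Set ℝ} (ht : IsOpen t) (hxt : U x ∈ t)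
    (hF : ContDiffOn ℝ ∞ F t) {ε B K L : ℝ} (hε : 0 ≤ ε) (hB : 0 ≤ B) (hK : 0 ≤ K) (hL : 0 ≤ L)
    (hFb : ∀ m, |iteratedDeriv m F (U x)| ≤ K * L ^ m * m.factorial)
    {k : ℕ} (hk : 1 ≤ k)
    (h : ∀ j, 1 ≤ j → j ≤ k → ‖iteratedFDeriv ℝ j U x‖ ≤ ε * B ^ j * j.factorial * wt j)
    (hsmall : 8 * ε * L ≤ 1 / 2) :
    ‖iteratedFDeriv ℝ k (fun y => F (U y)) x‖ ≤ K * B ^ k * k.factorial * wt k := by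
  set s0 := U x with hs0
  set T : ℝ → ℝ := taylorWithinEval F k Set.univ s0 with hT
  have hTe : T = fun s => ∑ m ∈ Finset.range (k + 1),
      ((m.factorial : ℝ)⁻¹ * (s - s0) ^ m) • iteratedDeriv m F s0 := by
    funext s
    rw [hT, taylor_within_apply]
    simp only [iteratedDerivWithin_univ]
  have hTc : ContDiff ℝ ∞ T := by
    rw [hTe]
    fun_prop
  set R : ℝ → ℝ := fun s => F s - T s with hR
  have hFat : ContDiffAt ℝ ∞ F s0 := hF.contDiffAt (ht.mem_nhds hxt)
  have hR0 : ∀ i ≤ k, iteratedDeriv i R s0 = 0 := by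
    intro i hi
    rw [hR, iteratedDeriv_fun_sub (hFat.of_le (by exact_mod_cast le_top))
      (hTc.contDiffAt.of_le (by exact_mod_cast le_top))]
    obtain ⟨n, rfl⟩ := Nat.exists_eq_add_of_le' hi
    rw [hT, iteratedDeriv_taylor, taylorWithinEval_self, sub_self]
  have hRon : ContDiffOn ℝ ∞ R t := hF.sub hTc.contDiffOn
  have hs : IsOpen (U ⁻¹' t) := ht.preimage hU.continuous
  have hRU : iteratedFDeriv ℝ k (R ∘ U) x = 0 := by
    set D : ℝ := 1 + ∑ i ∈ Finset.range (k + 1), ‖iteratedFDeriv ℝ i U x‖ with hD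
    have hsn : 0 ≤ ∑ i ∈ Finset.range (k + 1), ‖iteratedFDeriv ℝ i U x‖ :=
      Finset.sum_nonneg fun i _ => norm_nonneg _
    have hD1 : 1 ≤ D := by linarith
    have := norm_iteratedFDerivWithin_comp_le (n := k) (x := x) (C := 0) (D := D) hRon hU.contDiffOn
      (by exact_mod_cast le_top) ht.uniqueDiffOn hs.uniqueDiffOn (fun y hy => hy) hxt
      (fun i hi => by
        rw [iteratedFDerivWithin_of_isOpen i ht hxt, norm_iteratedFDeriv_eq_norm_iteratedDeriv,
          hR0 i hi, norm_zero])
      (fun i h1 hi => by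
        rw [iteratedFDerivWithin_of_isOpen i hs hxt]
        have a1 : ‖iteratedFDeriv ℝ i U x‖ ≤ ∑ i ∈ Finset.range (k + 1), ‖iteratedFDeriv ℝ i U x‖ :=
          Finset.single_le_sum (f := fun i => ‖iteratedFDeriv ℝ i U x‖) (fun i _ => norm_nonneg _)
            (Finset.mem_range.2 (Nat.lt_succ_iff.2 hi))
        calc ‖iteratedFDeriv ℝ i U x‖ ≤ D := by linarith
          _ ≤ D ^ i := le_self_pow₀ hD1 (by omega))
    rw [iteratedFDerivWithin_of_isOpen k hs hxt] at this
    simpa using this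
  have hsplit : (fun y => F (U y)) = (R ∘ U) + (fun y => T (U y)) := by
    funext y; simp [hR]
  have hRUc : ContDiffAt ℝ k (R ∘ U) x :=
    ((hRon.contDiffAt (ht.mem_nhds hxt)).comp x hU.contDiffAt).of_le (by exact_mod_cast le_top)
  have hTUc : ContDiff ℝ ∞ (fun y => T (U y)) := hTc.comp hU
  rw [hsplit, iteratedFDeriv_add_apply hRUc (hTUc.contDiffAt.of_le (by exact_mod_cast le_top)),
    hRU, zero_add]
  set v : EuclideanSpace ℝ (Fin d) → ℝ := fun y => U y - s0 with hv
  have hvc : ContDiff ℝ ∞ v := hU.sub contDiff_const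
  have hvb : ∀ j ≤ k, ‖iteratedFDeriv ℝ j v x‖ ≤ ε * B ^ j * j.factorial * wt j := by
    intro j hj
    have := (wt_pos j).le
    rcases Nat.eq_zero_or_pos j with rfl | hj0
    · rw [norm_iteratedFDeriv_zero, hv]
      simp only [hs0, sub_self, norm_zero]
      positivity
    · have e : iteratedFDeriv ℝ j v x = iteratedFDeriv ℝ j U x := by
        have e0 : v = U - fun _ => s0 := rfl
        rw [e0, iteratedFDeriv_sub_apply (hU.contDiffAt.of_le (by exact_mod_cast le_top)) contDiffAt_const,
          iteratedFDeriv_const_of_ne (by omega)]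
        simp
      rw [e]; exact h j hj0 hj
  have hTU : (fun y => T (U y)) = fun y => ∑ m ∈ Finset.range (k + 1),
      ((m.factorial : ℝ)⁻¹ * iteratedDeriv m F s0) • v y ^ m := by
    funext y
    rw [hTe]
    refine Finset.sum_congr rfl fun m _ => ?_
    simp only [hv, smul_eq_mul]; ring
  rw [hTU, iteratedFDeriv_fun_sum_apply (fun m _ => by
    exact (ContDiff.const_smul _ ((hvc.pow m).of_le (by exact_mod_cast le_top))).contDiffAt),
    Finset.sum_range_succ']
  have hz : iteratedFDeriv ℝ k (fun y => ((Nat.factorial 0 : ℝ)⁻¹ * iteratedDeriv 0 F s0) • v y ^ 0) x = 0 := by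
    simp only [pow_zero]
    rw [iteratedFDeriv_const_of_ne (by omega)]
    rfl
  rw [hz, add_zero]
  have hw := (wt_pos k).le
  calc _ ≤ ∑ m ∈ Finset.range k, (K * B ^ k * k.factorial * wt k) * ((1 / 2) ^ (m + 1)) := by
        refine norm_sum_le_of_le _ fun m _ => ?_
        have e : (fun y => (((m + 1).factorial : ℝ)⁻¹ * iteratedDeriv (m + 1) F s0) • v y ^ (m + 1)) =
          (((m + 1).factorial : ℝ)⁻¹ * iteratedDeriv (m + 1) F s0) • fun y => v y ^ (m + 1) := rfl
        rw [e, iteratedFDeriv_const_smul_apply ((hvc.pow (m + 1)).contDiffAt.of_le (by exact_mod_cast le_top)),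
          norm_smul]
        have h1 := pow_bound hvc x hε hB hvb m k le_rfl
        have hf : (0:ℝ) < (m + 1).factorial := by positivity
        have h2 : ‖((m + 1).factorial : ℝ)⁻¹ * iteratedDeriv (m + 1) F s0‖ ≤ K * L ^ (m + 1) := by
          rw [norm_mul, norm_inv, Real.norm_of_nonneg hf.le, inv_mul_le_iff₀ hf, Real.norm_eq_abs]
          refine (hFb (m + 1)).trans (le_of_eq ?_)
          ring
        calc _ ≤ (K * L ^ (m + 1)) * (ε * (8 * ε) ^ m * B ^ k * k.factorial * wt k) := by gcongr
          _ = (K * B ^ k * k.factorial * wt k) * (1 / 8) * (8 * ε * L) ^ (m + 1) := by ring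
          _ ≤ (K * B ^ k * k.factorial * wt k) * (1 / 8) * (1 / 2) ^ (m + 1) := by gcongr
          _ ≤ (K * B ^ k * k.factorial * wt k) * (1 / 2) ^ (m + 1) := by
            have : 0 ≤ (K * B ^ k * k.factorial * wt k) := by positivity
            have h3 : (0:ℝ) ≤ (1 / 2) ^ (m + 1) := by positivity
            have := mul_nonneg this h3
            linarith
    _ = (K * B ^ k * k.factorial * wt k) * ∑ m ∈ Finset.range k, ((1 / 2 : ℝ) ^ (m + 1)) := by
        rw [Finset.mul_sum]
    _ ≤ (K * B ^ k * k.factorial * wt k) * 1 := by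
        have : ∑ m ∈ Finset.range k, ((1 / 2 : ℝ) ^ (m + 1)) ≤ 1 := by
          have e : ∀ k : ℕ, ∑ m ∈ Finset.range k, ((1 / 2 : ℝ) ^ (m + 1)) = 1 - (1 / 2) ^ k := by
            intro k
            induction k with
            | zero => simp
            | succ k ih => rw [Finset.sum_range_succ, ih]; ring
          rw [e]
          have : (0:ℝ) ≤ (1 / 2) ^ k := by positivity
          linarith
        gcongr
    _ = _ := by ring


lemma analytic_bounds {f : ℝ → ℝ} {s0 : ℝ} (h : AnalyticAt ℝ f s0) :
    ∃ r > (0:ℝ), ∃ K > (0:ℝ), ∃ L > (0:ℝ), ∀ s, |s - s0| < r → ∀ m,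
      |iteratedDeriv m f s| ≤ K * L ^ m * m.factorial := by
  obtain ⟨p, R, hp⟩ := h
  obtain ⟨r, hr0, hrR⟩ : ∃ r : NNReal, 0 < r ∧ (r:ENNReal) + r < R := by
    obtain ⟨q, hq0, hqR⟩ := ENNReal.lt_iff_exists_nnreal_btwn.1 hp.r_pos
    refine ⟨q / 2, by simpa using hq0, ?_⟩
    rw [← ENNReal.coe_add, add_halves]; exact hqR
  have hrad : (r:ENNReal) + r < p.radius := hrR.trans_le hp.r_le
  have hs := p.changeOriginSeries_summable_aux₁ hrad
  set S := ∑' s : Σ k l : ℕ, { s : Finset (Fin (k + l)) // s.card = l },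
    ‖p (s.1 + s.2.1)‖₊ * r ^ s.2.1 * r ^ s.1 with hS
  refine ⟨r, hr0, S + 1, by positivity, (r:ℝ)⁻¹, by positivity, fun s hss m => ?_⟩
  have hy : (‖s - s0‖₊ : NNReal) ≤ r := by
    rw [← NNReal.coe_le_coe]; simpa using hss.le
  have hyR : (‖s - s0‖₊ : ENNReal) < R := by
    refine lt_of_le_of_lt ?_ hrR
    calc (‖s - s0‖₊ : ENNReal) ≤ r := by exact_mod_cast hy
      _ ≤ _ := le_self_add
  have h1 := hp.changeOrigin hyR
  rw [add_sub_cancel] at h1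
  have h2 := h1.factorial_smul 1 m
  rw [iteratedDeriv_eq_iteratedFDeriv, ← h2]
  have h3 : ‖p.changeOrigin (s - s0) m‖₊ * r ^ m ≤ S := by
    have e1 := p.nnnorm_changeOrigin_le m (x := s - s0) (by
      exact lt_of_lt_of_le hyR hp.r_le)
    have hs' : Summable fun s : Σ l : ℕ, { s : Finset (Fin (m + l)) // s.card = l } =>
      ‖p (m + s.1)‖₊ * r ^ s.1 * r ^ m :=
      (NNReal.summable_sigma.1 hs).1 m
    calc _ ≤ (∑' s_1 : Σ l : ℕ, { s : Finset (Fin (m + l)) // s.card = l },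
        ‖p (m + s_1.1)‖₊ * ‖s - s0‖₊ ^ s_1.1) * r ^ m := by gcongr
      _ = ∑' s_1 : Σ l : ℕ, { s : Finset (Fin (m + l)) // s.card = l },
        ‖p (m + s_1.1)‖₊ * ‖s - s0‖₊ ^ s_1.1 * r ^ m := by rw [NNReal.tsum_mul_right]
      _ ≤ ∑' s_1 : Σ l : ℕ, { s : Finset (Fin (m + l)) // s.card = l },
        ‖p (m + s_1.1)‖₊ * r ^ s_1.1 * r ^ m := by
          have hb : ∀ t : Σ l : ℕ, { s : Finset (Fin (m + l)) // s.card = l },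
            ‖p (m + t.1)‖₊ * ‖s - s0‖₊ ^ t.1 * r ^ m ≤ ‖p (m + t.1)‖₊ * r ^ t.1 * r ^ m := by
            intro t; gcongr
          exact (NNReal.summable_of_le hb hs').tsum_le_tsum hb hs'
      _ ≤ S := by
        have h5 := NNReal.summable_sigma.1 hs
        rw [hS, hs.tsum_sigma' h5.1]
        exact h5.2.le_tsum m (fun _ _ => zero_le)
  have h3' : ‖p.changeOrigin (s - s0) m‖ * r ^ m ≤ S := by exact_mod_cast h3
  have h4 : |(p.changeOrigin (s - s0) m) fun _ => 1| ≤ ‖p.changeOrigin (s - s0) m‖ := by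
    have := (p.changeOrigin (s - s0) m).le_opNorm (fun _ => 1)
    simpa using this
  rw [nsmul_eq_mul, abs_mul, Nat.abs_cast, mul_comm]
  gcongr
  refine h4.trans ?_
  rw [inv_pow, ← div_eq_mul_inv, le_div_iff₀ (by positivity)]
  linarith


lemma pow_three_bd (k : ℕ) : (((k:ℝ)+2)/(k+1))^k ≤ 3 := by
  have h1 : ((k:ℝ)+2)/(k+1) ≤ Real.exp (1/(k+1)) := by
    have := Real.add_one_le_exp (1/((k:ℝ)+1))
    have e : ((k:ℝ)+2)/(k+1) = 1/((k:ℝ)+1) + 1 := by field_simp; ring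
    rw [e]; exact this
  calc (((k:ℝ)+2)/(k+1))^k ≤ (Real.exp (1/(k+1)))^k := by gcongr
    _ = Real.exp (k * (1/(k+1))) := by rw [← Real.exp_nat_mul]
    _ ≤ Real.exp 1 := by
      apply Real.exp_le_exp.2
      rw [mul_one_div, div_le_one (by positivity)]; linarith
    _ ≤ 3 := by linarith [Real.exp_one_lt_d9]

lemma deriv_bounds {d : ℕ} {U : EuclideanSpace ℝ (Fin d) → ℝ} (hU : ContDiff ℝ ∞ U)
    {f : ℝ → ℝ} {t : Set ℝ} (ht : IsOpen t) (hF : ContDiffOn ℝ ∞ f t) {R K L M1 : ℝ}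
    (hR1 : R ≤ 1) (hK : 0 < K) (hL : 0 < L)
    (hUt : ∀ y, ‖y‖ < R → U y ∈ t)
    (hfb : ∀ y, ‖y‖ < R → ∀ m, |iteratedDeriv m f (U y)| ≤ K * L ^ m * m.factorial)
    (heq : ∀ y, ‖y‖ < R → VL U =ᶠ[𝓝 y] fun z => f (U z))
    (hM : ∀ y, ‖y‖ < R → ‖iteratedFDeriv ℝ 1 U y‖ ≤ M1) :
    ∃ ε > (0:ℝ), ∃ C > (0:ℝ), ∀ k, 1 ≤ k → ∀ x, ‖x‖ < R →
      ‖iteratedFDeriv ℝ k U x‖ ≤ ε * (C / (R - ‖x‖)) ^ k * k.factorial * wt k := by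
  set ε : ℝ := 1 / (16 * L) with hε
  have hε0 : 0 < ε := by positivity
  have hεL : 8 * ε * L ≤ 1 / 2 := by
    rw [hε]; apply le_of_eq; field_simp; norm_num
  set C : ℝ := max 1 (max (4 * M1 / ε) (8 * (3 * d^2 + 2 * K * d / ε))) with hC
  have hC0 : 0 < C := lt_of_lt_of_le one_pos (le_max_left _ _)
  have hC1 : 4 * M1 ≤ C * ε := by
    rw [← div_le_iff₀ hε0]; exact (le_max_left _ _).trans (le_max_right _ _)
  have hC2 : 8 * (3 * ε * d^2 + 2 * K * d) ≤ ε * C := by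
    have : 8 * (3 * d^2 + 2 * K * d / ε) ≤ C := (le_max_right _ _).trans (le_max_right _ _)
    calc _ = ε * (8 * (3 * d^2 + 2 * K * d / ε)) := by field_simp
      _ ≤ _ := by gcongr
  refine ⟨ε, hε0, C, hC0, fun k hk => ?_⟩
  induction k using Nat.strong_induction_on with
  | _ n ih =>
    intro x hx
    obtain ⟨k, rfl⟩ : ∃ k, n = k + 1 := ⟨n - 1, by omega⟩
    have hρ0 : 0 < R - ‖x‖ := by linarith
    have hρ1 : R - ‖x‖ ≤ 1 := by linarith [norm_nonneg x]
    set ρ := R - ‖x‖ with hρ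
    rcases Nat.eq_zero_or_pos k with rfl | hk0
    · refine (hM x hx).trans ?_
      simp only [zero_add, pow_one, Nat.factorial_one, Nat.cast_one, mul_one, wt]
      have : C ≤ C / ρ := by rw [le_div_iff₀ hρ0]; nlinarith
      have : ε * C ≤ ε * (C / ρ) := by gcongr
      norm_num
      linarith
    · set X : ℝ := (C / ρ)^k * k.factorial * wt k with hX
      have hwt := wt_pos k
      have hX0 : 0 < X := by positivity
      have hδ : 0 < ρ / (k+2) := by positivity
      have key : ∀ y, ‖y - x‖ ≤ ρ / (k+2) → ‖y‖ < R ∧ (C / (R - ‖y‖))^k ≤ 3 * (C / ρ)^k := by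
        intro y hy
        have h1 : ‖y‖ ≤ ‖x‖ + ρ / (k+2) := by
          have := norm_add_le (y - x) x
          rw [sub_add_cancel] at this; linarith
        have h2 : ρ * ((k+1)/(k+2)) ≤ R - ‖y‖ := by
          have : ρ * (((k:ℝ)+1)/(k+2)) = ρ - ρ / (k+2) := by field_simp; ring
          rw [this]; linarith
        have h3 : 0 < ρ * (((k:ℝ)+1)/(k+2)) := by positivity
        refine ⟨by linarith, ?_⟩
        calc (C / (R - ‖y‖))^k ≤ (C / (ρ * ((k+1)/(k+2))))^k := by
              have : 0 < R - ‖y‖ := by linarith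
              gcongr
          _ = (((k:ℝ)+2)/(k+1))^k * (C / ρ)^k := by rw [← mul_pow]; congr 1; field_simp
          _ ≤ _ := by gcongr; exact pow_three_bd k
      have main := grad_high x (M := 3 * ε * X) (N := 4 * K * X) hδ k hU (fun y hy => by
          obtain ⟨hyR, hyb⟩ := key y hy
          refine (ih k (by omega) hk0 y hyR).trans ?_
          calc _ ≤ ε * (3 * (C / ρ)^k) * k.factorial * wt k := by gcongr
            _ = _ := by rw [hX]; ring) (fun y hy => by
          obtain ⟨hyR, hyb⟩ := key y hy
          have hpos : 0 < R - ‖y‖ := by linarith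
          rw [((heq y hyR).iteratedFDeriv ℝ k).eq_of_nhds]
          have := comp_bound hU y ht (hUt y hyR) hF (ε := ε) (B := C / (R - ‖y‖)) (K := K) (L := L)
            hε0.le (by positivity) hK.le hL.le (hfb y hyR) hk0
            (fun j hj hjk => ih j (by omega) hj y hyR) hεL
          calc _ ≤ K * (C / (R - ‖y‖)) ^ k * k.factorial * wt k := this
            _ ≤ K * (3 * (C / ρ)^k) * k.factorial * wt k := by gcongr
            _ = 3 * (K * X) := by rw [hX]; ring
            _ < 4 * K * X := by
              have : 0 < K * X := by positivity
              linarith)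
      refine main.trans ?_
      have e1 : (d:ℝ) * (d * (3 * ε * X) / (ρ / (k + 2)) + 4 * K * X * (ρ / (k + 2)) / 2)
          ≤ X * ((k+2)/ρ) * (3 * ε * d^2 + 2 * K * d) := by
        have e2 : ρ / ((k:ℝ)+2) ≤ (k+2)/ρ := by
          rw [div_le_div_iff₀ (by positivity) hρ0]
          have : (0:ℝ) ≤ k := by positivity
          nlinarith
        calc _ = X * (3 * ε * d^2 * ((k+2)/ρ)) + X * (2 * K * d) * (ρ / ((k:ℝ)+2)) := by
              field_simp; ring
          _ ≤ X * (3 * ε * d^2 * ((k+2)/ρ)) + X * (2 * K * d) * ((k+2)/ρ) := by gcongr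
          _ = _ := by ring
      refine e1.trans ?_
      have e3 : wt k / 4 ≤ wt (k+1) := by
        simp only [wt]
        rw [div_div]
        apply one_div_le_one_div_of_le (by positivity)
        push_cast
        have : (0:ℝ) ≤ k := by positivity
        nlinarith
      calc X * ((k+2)/ρ) * (3 * ε * d^2 + 2 * K * d)
          ≤ X * (2 * (k+1)/ρ) * (ε * C / 8) := by
            have : (k:ℝ) + 2 ≤ 2 * (k+1) := by
              have : (0:ℝ) ≤ k := by positivity
              linarith
            gcongr
            linarith
        _ = ε * (C / ρ)^(k+1) * (k+1).factorial * (wt k / 4) := by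
            rw [hX, Nat.factorial_succ, pow_succ]; push_cast; ring
        _ ≤ _ := by gcongr


lemma line_deriv {d : ℕ} {U : EuclideanSpace ℝ (Fin d) → ℝ} (hU : ContDiff ℝ ∞ U)
    (x : EuclideanSpace ℝ (Fin d)) (m : ℕ) (t : ℝ) :
    iteratedDeriv m (fun s : ℝ => U (s • x)) t = iteratedFDeriv ℝ m U (t • x) (fun _ => x) := by
  have h := ((1 : ℝ →L[ℝ] ℝ).smulRight x).iteratedFDeriv_comp_right (n := ∞) hU t (i := m)
    (by exact_mod_cast le_top)
  rw [iteratedDeriv_eq_iteratedFDeriv]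
  have h2 : (fun s : ℝ => U (s • x)) = U ∘ ((1 : ℝ →L[ℝ] ℝ).smulRight x) := by
    funext s; simp
  rw [h2, h]
  simp [ContinuousMultilinearMap.compContinuousLinearMap_apply]

lemma taylor_sum {d : ℕ} {U : EuclideanSpace ℝ (Fin d) → ℝ} (hU : ContDiff ℝ ∞ U)
    {R A C : ℝ} (hA : 0 ≤ A) (hC : 0 ≤ C)
    (hb : ∀ k x, ‖x‖ < R → ‖iteratedFDeriv ℝ k U x‖ ≤ A * C ^ k * k.factorial)
    (x : EuclideanSpace ℝ (Fin d)) (hx : ‖x‖ < R) (hxC : C * ‖x‖ < 1) :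
    HasSum (fun m : ℕ => (m.factorial : ℝ)⁻¹ * iteratedFDeriv ℝ m U 0 (fun _ => x)) (U x) := by
  have hline : ∀ m t, t ∈ Set.Icc (0:ℝ) 1 →
      ‖iteratedFDeriv ℝ m U (t • x) (fun _ => x)‖ ≤ A * (C * ‖x‖) ^ m * m.factorial := by
    intro m t ht
    have h1 : ‖t • x‖ < R := by
      rw [norm_smul, Real.norm_of_nonneg ht.1]
      exact lt_of_le_of_lt (mul_le_of_le_one_left (norm_nonneg x) ht.2) hx
    refine ((iteratedFDeriv ℝ m U (t • x)).le_opNorm _).trans ?_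
    calc _ ≤ A * C ^ m * m.factorial * ∏ i : Fin m, ‖x‖ := by gcongr; exact hb m _ h1
      _ = _ := by simp [mul_pow]; ring
  have hq0 : 0 ≤ C * ‖x‖ := by positivity
  rw [hasSum_iff_tendsto_nat_of_summable_norm]
  · rw [← tendsto_add_atTop_iff_nat 1]
    rw [tendsto_iff_norm_sub_tendsto_zero]
    have hφ : ContDiff ℝ ∞ (fun s : ℝ => U (s • x)) := by fun_prop
    have hbound : ∀ n : ℕ, ‖∑ i ∈ Finset.range (n+1),
        (i.factorial : ℝ)⁻¹ * iteratedFDeriv ℝ i U 0 (fun _ => x) - U x‖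
        ≤ A * ((n + 1 : ℝ) * (C * ‖x‖) ^ (n+1)) := by
      intro n
      have hw : ∀ m : ℕ, ∀ t ∈ Set.Icc (0:ℝ) 1,
          iteratedDerivWithin m (fun s : ℝ => U (s • x)) (Set.Icc 0 1) t
            = iteratedFDeriv ℝ m U (t • x) (fun _ => x) := by
        intro m t ht
        rw [iteratedDerivWithin_eq_iteratedDeriv (uniqueDiffOn_Icc one_pos)
          (hφ.contDiffAt.of_le (by exact_mod_cast le_top)) ht, line_deriv hU]
      have h1 := taylor_mean_remainder_bound (f := fun s : ℝ => U (s • x)) (a := 0) (b := 1)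
        (x := 1) (n := n) (C := A * (C * ‖x‖) ^ (n+1) * (n+1).factorial) zero_le_one
        (hφ.contDiffOn.of_le (by exact_mod_cast le_top)) (by simp) (fun y hy => by
          rw [hw _ _ hy]; exact hline _ _ hy)
      rw [taylor_within_apply] at h1
      have h2 : ∑ k ∈ Finset.range (n + 1), ((k.factorial:ℝ)⁻¹ * (1 - 0) ^ k) •
          iteratedDerivWithin k (fun s : ℝ => U (s • x)) (Set.Icc 0 1) 0 =
          ∑ i ∈ Finset.range (n+1),
        (i.factorial : ℝ)⁻¹ * iteratedFDeriv ℝ i U 0 (fun _ => x) := by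
        refine Finset.sum_congr rfl fun k _ => ?_
        rw [hw k 0 (by simp)]; simp
      rw [h2, one_smul, norm_sub_rev] at h1
      refine h1.trans (le_of_eq ?_)
      rw [Nat.factorial_succ]; push_cast
      have : (n.factorial : ℝ) ≠ 0 := by positivity
      field_simp
      simp
    refine squeeze_zero (fun _ => norm_nonneg _) hbound ?_
    have h3 := tendsto_self_mul_const_pow_of_lt_one hq0 hxC
    have h4 := (h3.comp (tendsto_add_atTop_nat 1)).const_mul A
    simpa [Function.comp_def] using h4
  · refine Summable.of_nonneg_of_le (fun _ => norm_nonneg _) (fun m => ?_)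
      ((summable_geometric_of_lt_one hq0 hxC).mul_left A)
    have := hline m 0 (by simp)
    rw [zero_smul] at this
    rw [norm_mul, norm_inv, Real.norm_natCast]
    calc _ ≤ (m.factorial : ℝ)⁻¹ * (A * (C * ‖x‖) ^ m * m.factorial) := by gcongr
      _ = _ := by
        have : (m.factorial : ℝ) ≠ 0 := by positivity
        field_simp

lemma regularity {d : ℕ} {u : EuclideanSpace ℝ (Fin d) → ℝ} {f : ℝ → ℝ}
    (hu : ∀ n : ℕ, ContDiffOn ℝ n u (Metric.ball (0 : EuclideanSpace ℝ (Fin d)) 1))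
    (hf : ∃ a b : ℝ, (∀ x ∈ Metric.ball (0 : EuclideanSpace ℝ (Fin d)) 1, u x ∈ Set.Ioo a b) ∧
      AnalyticOnNhd ℝ f (Set.Ioo a b))
    (heq : ∀ x ∈ Metric.ball (0 : EuclideanSpace ℝ (Fin d)) 1, lap d u x = f (u x)) :
    ∃ U : EuclideanSpace ℝ (Fin d) → ℝ, ContDiff ℝ ∞ U ∧ ∃ R A C : ℝ, 0 < R ∧ R < 1 ∧
      0 ≤ A ∧ 0 ≤ C ∧ (∀ x, ‖x‖ < R → U x = u x) ∧
      ∀ k x, ‖x‖ < R → ‖iteratedFDeriv ℝ k U x‖ ≤ A * C ^ k * k.factorial := by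
  obtain ⟨a, b, hab, hfa⟩ := hf
  let χ : ContDiffBump (0 : EuclideanSpace ℝ (Fin d)) := ⟨1/2, 3/4, by norm_num, by norm_num⟩
  have hu' : ContDiffOn ℝ ∞ u (Metric.ball (0 : EuclideanSpace ℝ (Fin d)) 1) :=
    contDiffOn_infty.2 hu
  set U : EuclideanSpace ℝ (Fin d) → ℝ := fun x => χ x * u x with hUdef
  have hU : ContDiff ℝ ∞ U := by
    rw [contDiff_iff_contDiffAt]
    intro x
    by_cases hx : ‖x‖ < 1
    · exact χ.contDiff.contDiffAt.mul (hu'.contDiffAt (Metric.isOpen_ball.mem_nhds (by simpa using hx)))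
    · have : U =ᶠ[𝓝 x] fun _ => 0 := by
        have h1 : ∀ᶠ y in 𝓝 x, 3/4 < ‖y‖ :=
          (continuous_norm.tendsto x).eventually (lt_mem_nhds (by linarith [not_lt.1 hx]))
        filter_upwards [h1] with y hy
        have : χ y = 0 := χ.zero_of_le_dist (by
          rw [dist_zero_right]; exact hy.le)
        simp [hUdef, this]
      exact contDiffAt_const.congr_of_eventuallyEq this
  have hUu : ∀ x, ‖x‖ < 1/2 → U x = u x := by
    intro x hx
    have : χ x = 1 := χ.one_of_mem_closedBall (by
      rw [mem_closedBall_zero_iff]; exact hx.le)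
    simp [hUdef, this]
  have hUev : ∀ x, ‖x‖ < 1/2 → U =ᶠ[𝓝 x] u := by
    intro x hx
    filter_upwards [(continuous_norm.tendsto x).eventually (gt_mem_nhds hx)] with y hy
    exact hUu y hy
  have hVL : ∀ x, ‖x‖ < 1/2 → VL U x = f (U x) := by
    intro x hx
    rw [hUu x hx, ← heq x (by simp; linarith)]
    unfold VL lap
    refine Finset.sum_congr rfl fun i _ => ?_
    have h2 : (fun y => fderiv ℝ U y (EuclideanSpace.single i 1)) =ᶠ[𝓝 x]
        fun y => fderiv ℝ u y (EuclideanSpace.single i 1) := by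
      filter_upwards [(hUev x hx).fderiv (𝕜 := ℝ)] with y hy
      rw [hy]
    rw [h2.fderiv_eq]
  have h0 : U 0 ∈ Set.Ioo a b := by
    rw [hUu 0 (by simp)]; exact hab 0 (by simp)
  obtain ⟨r, hr, K, hK, L, hL, hfb⟩ := analytic_bounds (hfa _ h0)
  have hnear : ∀ᶠ x in 𝓝 (0 : EuclideanSpace ℝ (Fin d)), |U x - U 0| < r := by
    have h1 : Continuous fun x => |U x - U 0| := by
      have := hU.continuous; fun_prop
    have h2 := h1.tendsto 0
    exact h2.eventually (gt_mem_nhds (by simpa using hr))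
  obtain ⟨R1, hR1, hR1b⟩ := Metric.eventually_nhds_iff.1 hnear
  set R := min R1 (1/4) with hRdef
  have hR0 : 0 < R := by positivity
  have hR4 : R ≤ 1/4 := min_le_right _ _
  have hcpt : IsCompact (Metric.closedBall (0 : EuclideanSpace ℝ (Fin d)) 1) :=
    isCompact_closedBall _ _
  obtain ⟨M1, hM1⟩ := hcpt.exists_bound_of_continuousOn
    (f := fun x => iteratedFDeriv ℝ 1 U x) (hU.continuous_iteratedFDeriv (by exact_mod_cast le_top)).continuousOn
  obtain ⟨M0, hM0⟩ := hcpt.exists_bound_of_continuousOn (f := U) hU.continuous.continuousOn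
  obtain ⟨ε, hε, C, hC, hmain⟩ := deriv_bounds hU (t := Set.Ioo a b) isOpen_Ioo
    (hfa.contDiffOn isOpen_Ioo.uniqueDiffOn) (R := R) (M1 := M1) (by linarith) hK hL
    (fun y hy => by rw [hUu y (by linarith)]; exact hab y (by simp; linarith))
    (fun y hy => hfb _ (hR1b (by simpa using lt_of_lt_of_le hy (min_le_left _ _))))
    (fun y hy => by
      filter_upwards [(continuous_norm.tendsto y).eventually (gt_mem_nhds (show ‖y‖ < 1/2 by linarith))]
        with z hz
      exact hVL z hz)
    (fun y hy => hM1 y (by simp; linarith))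
  refine ⟨U, hU, R / 2, max M0 ε, 2 * C / R, by positivity, by linarith, ?_, by positivity,
    fun x hx => hUu x (by linarith), ?_⟩
  · exact le_trans hε.le (le_max_right _ _)
  · intro k x hx
    rcases Nat.eq_zero_or_pos k with rfl | hk
    · simpa using Or.inl (hM0 x (by simp; linarith))
    · refine (hmain k hk x (by linarith)).trans ?_
      have hw : wt k ≤ 1 := by
        unfold wt
        rw [div_le_one (by positivity)]
        have : (0:ℝ) ≤ k := by positivity
        nlinarith
      have h5 : C / (R - ‖x‖) ≤ 2 * C / R := by
        rw [div_le_div_iff₀ (by linarith) hR0]; nlinarith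
      have hw0 := wt_pos k
      have : 0 ≤ C / (R - ‖x‖) := div_nonneg hC.le (by linarith)
      calc _ ≤ max M0 ε * (2 * C / R) ^ k * k.factorial * 1 := by
            gcongr
            exact le_max_right _ _
        _ = _ := by ring


lemma nat_le_infty (n : ℕ) : ((n : ℕ) : ℕ∞ω) ≤ ∞ := by exact_mod_cast le_top

structure Hom {d : ℕ} (n : ℕ) (q : EuclideanSpace ℝ (Fin d) → ℝ) : Prop where
  smooth : ContDiff ℝ ∞ q
  hom : ∀ (t : ℝ) x, q (t • x) = t ^ n * q x

section
variable {d : ℕ}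

lemma Hom.apply {n : ℕ} {q : EuclideanSpace ℝ (Fin d) → ℝ} (h : Hom n q)
    (x : EuclideanSpace ℝ (Fin d)) :
    q x = (n.factorial : ℝ)⁻¹ * iteratedFDeriv ℝ n q 0 (fun _ => x) := by
  have h1 := line_deriv h.smooth x n 0
  rw [zero_smul] at h1
  rw [← h1]
  have h2 : (fun s : ℝ => q (s • x)) = fun s => s ^ n * q x := funext fun s => h.hom s x
  rw [h2, iteratedDeriv_mul_const_field, iteratedDeriv_pow]
  have : (n.factorial : ℝ) ≠ 0 := by positivity
  simp [Nat.descFactorial_self]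
  field_simp

lemma Hom.euler {n : ℕ} {q : EuclideanSpace ℝ (Fin d) → ℝ} (h : Hom n q)
    (x : EuclideanSpace ℝ (Fin d)) : fderiv ℝ q x x = n * q x := by
  have h1 := line_deriv h.smooth x 1 1
  have h2 : (fun s : ℝ => q (s • x)) = fun s => s ^ n * q x := funext fun s => h.hom s x
  rw [h2, iteratedDeriv_mul_const_field, iteratedDeriv_pow] at h1
  simp at h1
  exact h1.symm

lemma VL_scale {q : EuclideanSpace ℝ (Fin d) → ℝ} (hq : ContDiff ℝ ∞ q) (t : ℝ)
    (x : EuclideanSpace ℝ (Fin d)) : VL (fun y => q (t • y)) x = t ^ 2 * VL q (t • x) := by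
  unfold VL
  rw [Finset.mul_sum]
  refine Finset.sum_congr rfl fun i _ => ?_
  have h1 : (fun y => fderiv ℝ (fun y => q (t • y)) y (EuclideanSpace.single i 1)) =
      fun y => t • (fun z => fderiv ℝ q z (EuclideanSpace.single i 1)) (t • y) := by
    funext y
    rw [fderiv_comp_smul]; simp
  rw [h1]
  have h3 : Differentiable ℝ (fun z => fderiv ℝ q z (EuclideanSpace.single i 1)) :=
    (cd_diff (cd_fderiv hq)).clm_apply (differentiable_const _)
  have h2 : DifferentiableAt ℝ (fun y => (fun z => fderiv ℝ q z (EuclideanSpace.single i 1)) (t • y)) x := by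
    exact (h3 (t • x)).comp x (differentiableAt_id.const_smul t)
  rw [fderiv_fun_const_smul h2,
    fderiv_comp_smul (f := fun z => fderiv ℝ q z (EuclideanSpace.single i 1))]
  simp
  ring

lemma VL_add {p q : EuclideanSpace ℝ (Fin d) → ℝ} (hp : ContDiff ℝ ∞ p) (hq : ContDiff ℝ ∞ q)
    (x : EuclideanSpace ℝ (Fin d)) : VL (fun y => p y + q y) x = VL p x + VL q x := by
  rw [VL_eq' hp, VL_eq' hq, VL_eq' (hp.add hq)]
  have h1 : fderiv ℝ (fun y => p y + q y) = fun y => fderiv ℝ p y + fderiv ℝ q y := by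
    funext y; exact fderiv_fun_add (cd_diff hp y) (cd_diff hq y)
  beta_reduce
  rw [h1, fderiv_fun_add (cd_diff (cd_fderiv hp) x) (cd_diff (cd_fderiv hq) x)]
  simp [Finset.sum_add_distrib]

lemma VL_cmul {q : EuclideanSpace ℝ (Fin d) → ℝ} (hq : ContDiff ℝ ∞ q) (c : ℝ)
    (x : EuclideanSpace ℝ (Fin d)) : VL (fun y => c * q y) x = c * VL q x := by
  rw [VL_eq' hq, VL_eq' (contDiff_const.mul hq)]
  have h1 : fderiv ℝ (fun y => c * q y) = fun y => c • fderiv ℝ q y := by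
    funext y; exact fderiv_const_mul (cd_diff hq y) c
  beta_reduce
  rw [h1, fderiv_fun_const_smul (cd_diff (cd_fderiv hq) x)]
  simp [Finset.mul_sum]

lemma Hom.VL_key {n : ℕ} {q : EuclideanSpace ℝ (Fin d) → ℝ} (h : Hom n q) (t : ℝ)
    (x : EuclideanSpace ℝ (Fin d)) : t ^ 2 * VL q (t • x) = t ^ n * VL q x := by
  rw [← VL_scale h.smooth, ← VL_cmul h.smooth]
  congr 1
  funext y
  exact h.hom t y

lemma eq_of_ne_zero {F G : ℝ → ℝ} (hF : Continuous F) (hG : Continuous G)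
    (h : ∀ t, t ≠ 0 → F t = G t) : F = G :=
  hF.ext_on (dense_compl_singleton 0) hG (fun t ht => h t ht)

lemma Hom.VL_hom {n : ℕ} {q : EuclideanSpace ℝ (Fin d) → ℝ} (h : Hom (n + 2) q) :
    Hom n (VL q) := by
  refine ⟨VL_smooth h.smooth, fun t x => ?_⟩
  have hc := (VL_smooth h.smooth).continuous
  have := eq_of_ne_zero (F := fun t => VL q (t • x)) (G := fun t => t ^ n * VL q x)
    (by fun_prop) (by fun_prop) (fun t ht => by
      have h1 := h.VL_key t x
      have h2 : t ^ 2 ≠ 0 := pow_ne_zero 2 ht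
      apply mul_left_cancel₀ h2
      rw [h1]; ring)
  exact congrFun this t

lemma Hom.VL_low {n : ℕ} {q : EuclideanSpace ℝ (Fin d) → ℝ} (h : Hom n q) (hn : n < 2)
    (x : EuclideanSpace ℝ (Fin d)) : VL q x = 0 := by
  have hc := (VL_smooth h.smooth).continuous
  have := eq_of_ne_zero (F := fun t => t ^ (2 - n) * VL q (t • x)) (G := fun t => VL q x)
    (by fun_prop) (by fun_prop) (fun t ht => by
      have h1 := h.VL_key t x
      have h2 : t ^ n ≠ 0 := pow_ne_zero n ht
      apply mul_left_cancel₀ h2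
      rw [← h1, ← mul_assoc, ← pow_add]
      congr 2; omega)
  have h3 := congrFun this 0
  have h4 : 2 - n ≠ 0 := by omega
  simpa [h4] using h3.symm

lemma nsq_fderiv : fderiv ℝ (fun y : EuclideanSpace ℝ (Fin d) => ‖y‖ ^ 2) =
    fun y => (2 • innerSL ℝ : EuclideanSpace ℝ (Fin d) →L[ℝ] EuclideanSpace ℝ (Fin d) →L[ℝ] ℝ) y := by
  funext y
  have := (hasFDerivAt_id (𝕜 := ℝ) y).norm_sq
  simp only [id] at this
  rw [this.fderiv]
  ext v; simp; rfl

lemma VL_nsq_mul {n : ℕ} {q : EuclideanSpace ℝ (Fin d) → ℝ} (h : Hom n q)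
    (x : EuclideanSpace ℝ (Fin d)) :
    VL (fun y => ‖y‖ ^ 2 * q y) x = (2 * d + 4 * n) * q x + ‖x‖ ^ 2 * VL q x := by
  have hs : ContDiff ℝ ∞ (fun y : EuclideanSpace ℝ (Fin d) => ‖y‖ ^ 2) := contDiff_norm_sq ℝ
  have hd1 : ∀ y : EuclideanSpace ℝ (Fin d), HasFDerivAt (fun y : EuclideanSpace ℝ (Fin d) => ‖y‖ ^ 2)
      (2 • innerSL ℝ y) y := fun y => by
    have := (cd_diff hs y).hasFDerivAt
    rw [nsq_fderiv] at this
    exact this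
  have hq := fun y => (cd_diff h.smooth y).hasFDerivAt
  have e1 : ∀ i y, fderiv ℝ (fun y => ‖y‖ ^ 2 * q y) y (EuclideanSpace.single i 1) =
      ‖y‖ ^ 2 * fderiv ℝ q y (EuclideanSpace.single i 1) + q y * (2 * y i) := by
    intro i y
    rw [((hd1 y).fun_mul (hq y)).fderiv]
    simp [innerSL_apply_apply, EuclideanSpace.inner_single_right]
  have hcoord : ∀ (i : Fin d) y, HasFDerivAt (fun y : EuclideanSpace ℝ (Fin d) => 2 * y i)
      ((2:ℝ) • (EuclideanSpace.proj i : EuclideanSpace ℝ (Fin d) →L[ℝ] ℝ)) y := by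
    intro i y
    exact ((EuclideanSpace.proj i : EuclideanSpace ℝ (Fin d) →L[ℝ] ℝ).hasFDerivAt).const_mul 2
  have e2 : ∀ i, fderiv ℝ (fun y => fderiv ℝ (fun y => ‖y‖ ^ 2 * q y) y (EuclideanSpace.single i 1)) x
      (EuclideanSpace.single i 1) = ‖x‖ ^ 2 * fderiv ℝ (fun y => fderiv ℝ q y (EuclideanSpace.single i 1)) x
      (EuclideanSpace.single i 1) + 4 * (x i * fderiv ℝ q x (EuclideanSpace.single i 1)) + 2 * q x := by
    intro i
    simp_rw [e1 i]
    have h3 : HasFDerivAt (fun z => fderiv ℝ q z (EuclideanSpace.single i 1)) _ x :=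
      (((cd_diff (cd_fderiv h.smooth)).clm_apply (differentiable_const _)) x).hasFDerivAt
    rw [(((hd1 x).fun_mul h3).fun_add ((hq x).fun_mul (hcoord i x))).fderiv]
    simp [innerSL_apply_apply, EuclideanSpace.inner_single_right]
    ring
  have e3 : ∑ i : Fin d, x i * fderiv ℝ q x (EuclideanSpace.single i 1) = n * q x := by
    rw [← h.euler]
    have hx : x = ∑ i : Fin d, x i • EuclideanSpace.single i (1:ℝ) := by
      have := (EuclideanSpace.basisFun (Fin d) ℝ).sum_repr x
      simpa using this.symm
    conv_rhs => rw [hx, map_sum]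
    simp only [map_smul, smul_eq_mul]
    rw [← hx]
  unfold VL
  simp_rw [e2]
  rw [Finset.sum_add_distrib, Finset.sum_add_distrib, ← Finset.mul_sum, ← Finset.mul_sum, e3]
  simp
  ring

lemma Hom.nsq_mul {n : ℕ} {q : EuclideanSpace ℝ (Fin d) → ℝ} (h : Hom n q) :
    Hom (n + 2) (fun y => ‖y‖ ^ 2 * q y) := by
  refine ⟨(contDiff_norm_sq ℝ).mul h.smooth, fun t x => ?_⟩
  simp only [norm_smul, h.hom, mul_pow, Real.norm_eq_abs, sq_abs]
  ring

lemma Hom.lin {n : ℕ} {p q : EuclideanSpace ℝ (Fin d) → ℝ} (hp : Hom n p) (hq : Hom n q) (a b : ℝ) :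
    Hom n (fun y => a * p y + b * q y) := by
  refine ⟨(contDiff_const.mul hp.smooth).add (contDiff_const.mul hq.smooth), fun t x => ?_⟩
  simp only [hp.hom, hq.hom]
  ring

/-- normalized coefficient norm -/
noncomputable def nu (n : ℕ) (q : EuclideanSpace ℝ (Fin d) → ℝ) : ℝ :=
  ‖iteratedFDeriv ℝ n q 0‖ / n.factorial

lemma nu_nonneg (n : ℕ) (q : EuclideanSpace ℝ (Fin d) → ℝ) : 0 ≤ nu n q := by
  unfold nu; positivity

lemma nu_lin {n : ℕ} {p q : EuclideanSpace ℝ (Fin d) → ℝ} (hp : ContDiff ℝ ∞ p)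
    (hq : ContDiff ℝ ∞ q) (a b : ℝ) :
    nu n (fun y => a * p y + b * q y) ≤ |a| * nu n p + |b| * nu n q := by
  unfold nu
  have hn : ((n:ℕ) : ℕ∞ω) ≤ ∞ := by exact_mod_cast le_top
  have h1 : iteratedFDeriv ℝ n (fun y => a * p y + b * q y) 0 =
      a • iteratedFDeriv ℝ n p 0 + b • iteratedFDeriv ℝ n q 0 := by
    have e1 := iteratedFDeriv_add_apply (𝕜 := ℝ) (i := n) (x := 0) (f := fun y => a • p y)
      (g := fun y => b • q y) ((hp.const_smul a).contDiffAt.of_le hn) ((hq.const_smul b).contDiffAt.of_le hn)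
    have e2 := iteratedFDeriv_const_smul_apply (𝕜 := ℝ) (a := a) (x := 0) (i := n) (hp.contDiffAt.of_le hn)
    have e3 := iteratedFDeriv_const_smul_apply (𝕜 := ℝ) (a := b) (x := 0) (i := n) (hq.contDiffAt.of_le hn)
    rw [← e2, ← e3]
    exact e1
  rw [h1, mul_div_assoc', mul_div_assoc', ← add_div]
  gcongr
  refine (norm_add_le _ _).trans ?_
  rw [norm_smul, norm_smul]; simp

lemma nu_VL {n : ℕ} {q : EuclideanSpace ℝ (Fin d) → ℝ} (hq : ContDiff ℝ ∞ q) :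
    nu n (VL q) ≤ d * ((n + 2) * (n + 1)) * nu (n + 2) q := by
  have h1 : ‖iteratedFDeriv ℝ n (VL q) 0‖ ≤ d * ‖iteratedFDeriv ℝ (n + 2) q 0‖ := by
    have hn : ((n:ℕ) : ℕ∞ω) ≤ ∞ := by exact_mod_cast le_top
    have h2 := cd_fderiv (cd_fderiv hq)
    have h3 : ∀ i : Fin d, ContDiff ℝ ∞ fun x => fderiv ℝ (fderiv ℝ q) x (EuclideanSpace.single i 1) :=
      fun i => h2.clm_apply contDiff_const
    have h4 : ∀ i : Fin d, ContDiff ℝ ∞ fun x => fderiv ℝ (fderiv ℝ q) x (EuclideanSpace.single i 1)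
      (EuclideanSpace.single i 1) :=
      fun i => (h3 i).clm_apply contDiff_const
    rw [VL_eq' hq, iteratedFDeriv_fun_sum_apply (fun i _ => ((h4 i).of_le hn).contDiffAt)]
    refine (norm_sum_le _ _).trans ?_
    calc _ ≤ ∑ i : Fin d, ‖iteratedFDeriv ℝ (n + 2) q 0‖ := by
          refine Finset.sum_le_sum fun i _ => ?_
          refine (norm_iteratedFDeriv_clm_apply_const ((h3 i).of_le hn).contDiffAt le_rfl).trans ?_
          have := norm_iteratedFDeriv_clm_apply_const (c := EuclideanSpace.single i (1:ℝ))
            ((h2.of_le hn).contDiffAt (x := 0)) le_rfl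
          rw [norm_iteratedFDeriv_fderiv, norm_iteratedFDeriv_fderiv] at this
          simpa using this
      _ = _ := by simp
  unfold nu
  rw [Nat.factorial_succ, Nat.factorial_succ, div_le_iff₀ (by positivity)]
  refine h1.trans (le_of_eq ?_)
  push_cast
  have : (n.factorial : ℝ) ≠ 0 := by positivity
  field_simp
  ring

lemma nsq_iter (i : ℕ) : ‖iteratedFDeriv ℝ i (fun y : EuclideanSpace ℝ (Fin d) => ‖y‖ ^ 2) 0‖
    ≤ if i = 2 then 2 else 0 := by
  rcases i with _ | _ | _ | i
  · simp
  · rw [← norm_iteratedFDeriv_fderiv, norm_iteratedFDeriv_zero, nsq_fderiv]; simp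
  · rw [← norm_iteratedFDeriv_fderiv, ← norm_iteratedFDeriv_fderiv, norm_iteratedFDeriv_zero, nsq_fderiv]
    rw [ContinuousLinearMap.fderiv]
    simp only [zero_add, if_true]
    refine ContinuousLinearMap.opNorm_le_bound _ (by norm_num) fun v => ?_
    have : (2 • innerSL ℝ : EuclideanSpace ℝ (Fin d) →L[ℝ] EuclideanSpace ℝ (Fin d) →L[ℝ] ℝ) v
      = (2:ℝ) • innerSL ℝ v := by ext w; simp; rfl
    rw [this, norm_smul, innerSL_apply_norm]; simp
  · rw [← norm_iteratedFDeriv_fderiv, ← norm_iteratedFDeriv_fderiv, nsq_fderiv]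
    have : fderiv ℝ (fun y : EuclideanSpace ℝ (Fin d) => (2 • innerSL ℝ : EuclideanSpace ℝ (Fin d) →L[ℝ] EuclideanSpace ℝ (Fin d) →L[ℝ] ℝ) y)
      = fun _ => (2 • innerSL ℝ : EuclideanSpace ℝ (Fin d) →L[ℝ] EuclideanSpace ℝ (Fin d) →L[ℝ] ℝ) := by
      funext y; rw [ContinuousLinearMap.fderiv]
    rw [this, iteratedFDeriv_succ_const]
    simp

lemma nu_nsq {n : ℕ} {q : EuclideanSpace ℝ (Fin d) → ℝ} (hq : ContDiff ℝ ∞ q) :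
    nu (n + 2) (fun y => ‖y‖ ^ 2 * q y) ≤ nu n q := by
  have h1 := norm_iteratedFDeriv_mul_le (𝕜 := ℝ) (N := ∞)
    (contDiff_norm_sq ℝ (E := EuclideanSpace ℝ (Fin d))) hq 0 (n := n + 2)
    (nat_le_infty (n + 2))
  have h2 : ∑ i ∈ Finset.range (n + 2 + 1), ((n + 2).choose i : ℝ) *
      ‖iteratedFDeriv ℝ i (fun y : EuclideanSpace ℝ (Fin d) => ‖y‖ ^ 2) 0‖ * ‖iteratedFDeriv ℝ (n + 2 - i) q 0‖
      ≤ ((n + 2).choose 2 : ℝ) * 2 * ‖iteratedFDeriv ℝ n q 0‖ := by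
    calc _ ≤ ∑ i ∈ Finset.range (n + 2 + 1), ((n + 2).choose i : ℝ) *
          (if i = 2 then 2 else 0) * ‖iteratedFDeriv ℝ (n + 2 - i) q 0‖ := by
            gcongr with i _; exact nsq_iter i
      _ = _ := by
        rw [Finset.sum_eq_single 2]
        · simp only [if_true]; rfl
        · intro i _ hi; simp [hi]
        · intro h; simp at h
  unfold nu
  rw [div_le_div_iff₀ (by positivity) (by positivity)]
  have h3 : ((n + 2).choose 2 : ℝ) * 2 = (n + 2) * (n + 1) := by
    rw [Nat.cast_choose_two]; push_cast; ring
  rw [h3] at h2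
  calc _ ≤ ((n + 2) * (n + 1) * ‖iteratedFDeriv ℝ n q 0‖) * n.factorial := by
        gcongr; exact h1.trans h2
    _ = _ := by
      rw [Nat.factorial_succ, Nat.factorial_succ]; push_cast; ring
end


section
variable {d : ℕ}

lemma solve_aux (hd : 2 ≤ d) (N : ℕ) {X : ℝ} (hX : X = d * (N + 1)) : ∀ n j : ℕ, n + 2 * j = N →
    ∀ a : ℝ, 4 * j * ((N:ℝ) - j + 1) ≤ a → ∀ p : EuclideanSpace ℝ (Fin d) → ℝ, Hom n p →
    ∃ w : EuclideanSpace ℝ (Fin d) → ℝ, Hom n w ∧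
      (∀ x, a * w x + VL (fun y => ‖y‖ ^ 2 * w y) x = p x) ∧
      X ^ j / j.factorial * nu n w ≤
        (Real.exp X - ∑ l ∈ Finset.range j, X ^ l / l.factorial) * nu n p := by
  have hd' : (2:ℝ) ≤ d := by exact_mod_cast hd
  have hX0 : 0 < X := by rw [hX]; positivity
  intro n
  induction n using Nat.strong_induction_on with
  | _ n ih =>
    intro j hj a ha p hp
    set A : ℝ := a + 2 * d + 4 * n with hA
    have hNr : (N:ℝ) = n + 2 * j := by exact_mod_cast hj.symm
    have hn0 : (0:ℝ) ≤ n := by positivity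
    have hj0 : (0:ℝ) ≤ j := by positivity
    have hA4 : 4 * ((j:ℝ) + 1) * (N - j) + 4 ≤ A := by rw [hA]; nlinarith
    have hA1 : 1 ≤ A := by
      have : 0 ≤ 4 * ((j:ℝ) + 1) * (N - j) := by
        have : (0:ℝ) ≤ N - j := by linarith
        positivity
      linarith
    have hA0 : 0 < A := by linarith
    have hAi : A⁻¹ ≤ 1 := inv_le_one_of_one_le₀ hA1
    have hnp := nu_nonneg n p
    have hT : 0 ≤ Real.exp X - ∑ l ∈ Finset.range (j + 1), X ^ l / l.factorial :=
      sub_nonneg.2 (Real.sum_le_exp_of_nonneg hX0.le _)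
    have hTs : Real.exp X - ∑ l ∈ Finset.range j, X ^ l / l.factorial = X ^ j / j.factorial +
        (Real.exp X - ∑ l ∈ Finset.range (j + 1), X ^ l / l.factorial) := by
      rw [Finset.sum_range_succ]; ring
    set T := Real.exp X - ∑ l ∈ Finset.range (j + 1), X ^ l / l.factorial with hTdef
    rw [hTs]
    rcases lt_or_ge n 2 with hn | hn
    · have hw : Hom n (fun y => A⁻¹ * p y + 0 * p y) := hp.lin hp _ _
      refine ⟨_, hw, fun x => ?_, ?_⟩
      · rw [VL_nsq_mul hw, hw.VL_low hn]
        have : A * (A⁻¹ * p x) = p x := by field_simp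
        rw [hA] at this ⊢
        linear_combination this
      · have h1 := nu_lin (n := n) hp.smooth hp.smooth A⁻¹ 0
        have h2 : |A⁻¹| = A⁻¹ := abs_of_pos (by positivity)
        rw [h2, abs_zero, zero_mul, add_zero] at h1
        have h3 : A⁻¹ * nu n p ≤ nu n p := mul_le_of_le_one_left hnp hAi
        calc _ ≤ X ^ j / j.factorial * nu n p := by gcongr; exact h1.trans h3
          _ ≤ _ := by gcongr; linarith
    · obtain ⟨k, rfl⟩ : ∃ k, n = k + 2 := ⟨n - 2, by omega⟩
      obtain ⟨v, hv, hve, hvb⟩ := ih k (by omega) (j + 1) (by omega) A (by push_cast; linarith)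
        (VL p) hp.VL_hom
      have hv2 := hv.nsq_mul
      have hw := hp.lin hv2 A⁻¹ (-A⁻¹)
      refine ⟨_, hw, fun x => ?_, ?_⟩
      · rw [VL_nsq_mul hw, VL_add (contDiff_const.mul hp.smooth) (contDiff_const.mul hv2.smooth),
          VL_cmul hp.smooth, VL_cmul hv2.smooth]
        have e1 := hve x
        have e2 : A * A⁻¹ = 1 := mul_inv_cancel₀ hA0.ne'
        have e3 : a + (2 * d + 4 * ((k + 2 : ℕ):ℝ)) = A := by rw [hA]; ring
        have e4 : VL (fun y => ‖y‖ ^ 2 * v y) x = VL p x - A * v x := by linarith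
        rw [e4, ← add_assoc, ← add_mul, e3]
        linear_combination (p x) * e2
      · have h1 := nu_lin (n := k + 2) hp.smooth hv2.smooth A⁻¹ (-A⁻¹)
        have h2 : |A⁻¹| = A⁻¹ := abs_of_pos (by positivity)
        rw [abs_neg, h2] at h1
        have h3 := nu_nsq (n := k) hv.smooth
        have h4 := nu_VL (n := k) hp.smooth
        have hnv := nu_nonneg k v
        have hc : ((j:ℝ) + 1) * (d * ((k + 2) * (k + 1))) ≤ A * X := by
          have hk : ((k + 2 : ℕ):ℝ) = k + 2 := by push_cast; ring
          rw [hk] at hNr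
          have : (0:ℝ) ≤ k := by positivity
          calc ((j:ℝ) + 1) * (d * ((k + 2) * (k + 1))) ≤ (j + 1) * (d * ((N - j) * (N + 1))) := by
                gcongr <;> linarith
            _ = ((j + 1) * (N - j)) * X := by rw [hX]; ring
            _ ≤ A * X := by
              have : 0 ≤ ((j:ℝ) + 1) * (N - j) := by
                have : (0:ℝ) ≤ N - j := by linarith
                positivity
              gcongr; linarith
        have h5 : X ^ j / j.factorial * nu k v ≤ A * (T * nu (k + 2) p) := by
          have e5 : X ^ j / j.factorial * nu k v = (j + 1) / X * (X ^ (j + 1) / (j + 1).factorial * nu k v) := by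
            rw [Nat.factorial_succ, pow_succ]; push_cast
            have : (j.factorial : ℝ) ≠ 0 := by positivity
            field_simp
          rw [e5]
          calc _ ≤ (j + 1) / X * (T * (d * ((k + 2) * (k + 1)) * nu (k + 2) p)) := by
                refine mul_le_mul_of_nonneg_left (hvb.trans ?_) (by positivity)
                gcongr
            _ = ((j + 1) * (d * ((k + 2) * (k + 1)))) / X * (T * nu (k + 2) p) := by ring
            _ ≤ A * (T * nu (k + 2) p) := by
                gcongr
                rw [div_le_iff₀ hX0]; exact hc
        have hXj : 0 < X ^ j / (j.factorial : ℝ) := by positivity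
        calc _ ≤ X ^ j / j.factorial * (A⁻¹ * nu (k + 2) p + A⁻¹ * nu k v) := by
              gcongr
              refine h1.trans ?_
              gcongr
          _ = A⁻¹ * (X ^ j / j.factorial * nu (k + 2) p) + A⁻¹ * (X ^ j / j.factorial * nu k v) := by ring
          _ ≤ 1 * (X ^ j / j.factorial * nu (k + 2) p) + A⁻¹ * (A * (T * nu (k + 2) p)) := by gcongr
          _ = _ := by field_simp

lemma fischer_hom (hd : 2 ≤ d) {n : ℕ} {q : EuclideanSpace ℝ (Fin d) → ℝ} (hq : Hom (n + 2) q) :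
    ∃ g : EuclideanSpace ℝ (Fin d) → ℝ, Hom n g ∧
      (∀ x, VL (fun y => q y - ‖y‖ ^ 2 * g y) x = 0) ∧
      nu n g ≤ Real.exp (d * (n + 1)) * (d * ((n + 2) * (n + 1))) * nu (n + 2) q := by
  obtain ⟨g, hg, he, hb⟩ := solve_aux hd n rfl n 0 (by simp) 0 (by simp) (VL q) hq.VL_hom
  refine ⟨g, hg, fun x => ?_, ?_⟩
  · have h1 : (fun y => q y - ‖y‖ ^ 2 * g y) = fun y => q y + (-1) * (‖y‖ ^ 2 * g y) := by
      funext y; ring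
    rw [h1, VL_add hq.smooth (contDiff_const.mul hg.nsq_mul.smooth), VL_cmul hg.nsq_mul.smooth]
    have := he x
    linarith
  · simp only [pow_zero, Nat.factorial_zero, Nat.cast_one, div_one, one_mul, Finset.range_zero,
      Finset.sum_empty, sub_zero] at hb
    refine hb.trans ?_
    rw [mul_assoc]
    gcongr
    exact nu_VL hq.smooth
end


section
variable {d : ℕ}

lemma diag_smooth {m : ℕ} (T : ContinuousMultilinearMap ℝ (fun _ : Fin m => EuclideanSpace ℝ (Fin d)) ℝ) :
    ContDiff ℝ ∞ (fun x => T (fun _ => x)) := by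
  exact T.contDiff.comp (contDiff_pi.2 fun _ => contDiff_id)

lemma diag_iter {m : ℕ} (T : ContinuousMultilinearMap ℝ (fun _ : Fin m => EuclideanSpace ℝ (Fin d)) ℝ)
    (k : ℕ) (x : EuclideanSpace ℝ (Fin d)) :
    ‖iteratedFDeriv ℝ k (fun x => T (fun _ => x)) x‖ ≤ m.descFactorial k * ‖T‖ * ‖x‖ ^ (m - k) := by
  let D : EuclideanSpace ℝ (Fin d) →L[ℝ] (Fin m → EuclideanSpace ℝ (Fin d)) :=
    ContinuousLinearMap.pi fun _ => ContinuousLinearMap.id ℝ _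
  have hD : ‖D‖ ≤ 1 := by
    refine D.opNorm_le_bound zero_le_one fun v => ?_
    rw [one_mul, pi_norm_le_iff_of_nonneg (norm_nonneg v)]
    intro i; simp [D]
  have h1 := D.iteratedFDeriv_comp_right (n := ∞) (f := T) T.contDiff x (i := k) (nat_le_infty k)
  have h2 : (fun x => T (fun _ => x)) = T ∘ D := by funext x; simp [D]
  rw [h2, h1]
  refine (ContinuousMultilinearMap.norm_compContinuousLinearMap_le _ _).trans ?_
  have h3 := T.norm_iteratedFDeriv_le k (D x)
  have h4 : ‖D x‖ ≤ ‖x‖ := by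
    have := D.le_of_opNorm_le hD x; simpa using this
  calc _ ≤ ‖iteratedFDeriv ℝ k T (D x)‖ * 1 := by
        gcongr
        exact Finset.prod_le_one (fun _ _ => norm_nonneg _) (fun _ _ => hD)
    _ ≤ _ := by
        rw [mul_one]
        refine h3.trans ?_
        rw [Fintype.card_fin]
        gcongr

lemma diag_hom {m : ℕ} (T : ContinuousMultilinearMap ℝ (fun _ : Fin m => EuclideanSpace ℝ (Fin d)) ℝ) :
    Hom m (fun x => T (fun _ => x)) := by
  refine ⟨diag_smooth T, fun t x => ?_⟩
  have := T.map_smul_univ (fun _ => t) (fun _ => x)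
  simpa using this

lemma diag_nu {m : ℕ} (T : ContinuousMultilinearMap ℝ (fun _ : Fin m => EuclideanSpace ℝ (Fin d)) ℝ) :
    nu m (fun x => T (fun _ => x)) ≤ ‖T‖ := by
  unfold nu
  rw [div_le_iff₀ (by positivity)]
  refine (diag_iter T m 0).trans (le_of_eq ?_)
  rw [Nat.descFactorial_self, Nat.sub_self, pow_zero]; ring

lemma Hom.iter {m : ℕ} {q : EuclideanSpace ℝ (Fin d) → ℝ} (h : Hom m q) (k : ℕ)
    (x : EuclideanSpace ℝ (Fin d)) :
    ‖iteratedFDeriv ℝ k q x‖ ≤ m.descFactorial k * nu m q * ‖x‖ ^ (m - k) := by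
  have h1 : q = fun x => ((m.factorial : ℝ)⁻¹ • iteratedFDeriv ℝ m q 0) (fun _ => x) := by
    funext x; rw [h.apply x]; simp
  have h2 := diag_iter ((m.factorial : ℝ)⁻¹ • iteratedFDeriv ℝ m q 0) k x
  rw [← h1] at h2
  refine h2.trans (le_of_eq ?_)
  rw [norm_smul, nu, norm_inv, Real.norm_natCast, div_eq_inv_mul]

lemma Hom.iter_bound {m : ℕ} {q : EuclideanSpace ℝ (Fin d) → ℝ} (h : Hom m q) {B K r : ℝ}
    (hB : 0 ≤ B) (hK : 0 ≤ K) (hr : 0 < r) (hnu : nu m q ≤ B * K ^ m) (k : ℕ)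
    (x : EuclideanSpace ℝ (Fin d)) (hx : ‖x‖ < r) :
    ‖iteratedFDeriv ℝ k q x‖ ≤ B / r ^ k * ((m:ℝ) ^ k * (K * r) ^ m) := by
  refine (h.iter k x).trans ?_
  rcases lt_or_ge m k with hmk | hmk
  · rw [Nat.descFactorial_of_lt hmk]; simp; positivity
  · calc _ ≤ (m:ℝ) ^ k * (B * K ^ m) * r ^ (m - k) := by
          have := nu_nonneg m q
          gcongr
          exact_mod_cast Nat.descFactorial_le_pow m k
      _ = _ := by
        have : r ^ m = r ^ (m - k) * r ^ k := by rw [← pow_add]; congr 1; omega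
        rw [mul_pow, this]
        field_simp

lemma hasSum_clm {E F : Type} [NormedAddCommGroup E] [NormedSpace ℝ E] [NormedAddCommGroup F]
    [NormedSpace ℝ F] {f : ℕ → E →L[ℝ] F} {S : E →L[ℝ] F} (h : HasSum f S) (v : E) :
    HasSum (fun m => f m v) (S v) :=
  h.mapL (ContinuousLinearMap.apply ℝ F v)

lemma tsum_fd {E F : Type} [NormedAddCommGroup E] [NormedSpace ℝ E] [NormedAddCommGroup F]
    [NormedSpace ℝ F] [CompleteSpace F] {r : ℝ} (hr : 0 < r) (f : ℕ → E → F)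
    (hf : ∀ m z, DifferentiableAt ℝ (f m) z) {a b : ℕ → ℝ} (ha : Summable a) (hb : Summable b)
    (h0 : ∀ m, ‖f m 0‖ ≤ a m) (h1 : ∀ m y, ‖y‖ < r → ‖fderiv ℝ (f m) y‖ ≤ b m) (y : E) (hy : ‖y‖ < r) :
    HasFDerivAt (fun y => ∑' m, f m y) (∑' m, fderiv ℝ (f m) y) y := by
  have h00 : (0 : E) ∈ Metric.ball (0 : E) r := by simpa
  exact hasFDerivAt_tsum_of_isPreconnected hb Metric.isOpen_ball (convex_ball (0:E) r).isPreconnected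
      (fun m z _ => (hf m z).hasFDerivAt)
      (fun m z hz => h1 m z (by simpa using hz)) h00
      (Summable.of_norm_bounded ha h0) (by simpa using hy)

lemma tsum_fd2 {E F : Type} [NormedAddCommGroup E] [NormedSpace ℝ E] [NormedAddCommGroup F]
    [NormedSpace ℝ F] [CompleteSpace F] {r : ℝ} (hr : 0 < r) (f : ℕ → E → F)
    (hf : ∀ m z, DifferentiableAt ℝ (f m) z) (hf' : ∀ m z, DifferentiableAt ℝ (fderiv ℝ (f m)) z)
    {a b c : ℕ → ℝ} (ha : Summable a) (hb : Summable b) (hc : Summable c)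
    (h0 : ∀ m, ‖f m 0‖ ≤ a m) (h1 : ∀ m y, ‖y‖ < r → ‖fderiv ℝ (f m) y‖ ≤ b m)
    (h2 : ∀ m y, ‖y‖ < r → ‖fderiv ℝ (fderiv ℝ (f m)) y‖ ≤ c m) (x : E) (hx : ‖x‖ < r) :
    HasFDerivAt (fderiv ℝ (fun y => ∑' m, f m y)) (∑' m, fderiv ℝ (fderiv ℝ (f m)) x) x := by
  have s2 := tsum_fd hr (fun m => fderiv ℝ (f m)) hf' hb hc (fun m => h1 m 0 (by simpa)) h2 x hx
  refine s2.congr_of_eventuallyEq ?_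
  filter_upwards [(continuous_norm.tendsto x).eventually (gt_mem_nhds hx)] with y hy
  exact (tsum_fd hr f hf ha hb h0 h1 y hy).fderiv

lemma hasSum_bdd {E F : Type} [NormedAddCommGroup E] [NormedSpace ℝ E] [NormedAddCommGroup F]
    [NormedSpace ℝ F] [CompleteSpace F] {f : ℕ → E →L[ℝ] F}
    {c : ℕ → ℝ} (hc : Summable c) (h2 : ∀ m, ‖f m‖ ≤ c m) (v : E) :
    HasSum (fun m => f m v) ((∑' m, f m) v) :=
  hasSum_clm (Summable.of_norm_bounded hc h2).hasSum v

lemma tsum_fd2_apply {E F : Type} [NormedAddCommGroup E] [NormedSpace ℝ E] [NormedAddCommGroup F]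
    [NormedSpace ℝ F] [CompleteSpace F] (f : ℕ → E → F)
    {c : ℕ → ℝ} (hc : Summable c) (x : E) 
    (h2 : ∀ m, ‖fderiv ℝ (fderiv ℝ (f m)) x‖ ≤ c m) (v w : E) :
    HasSum (fun m => fderiv ℝ (fderiv ℝ (f m)) x v w) ((∑' m, fderiv ℝ (fderiv ℝ (f m)) x) v w) := by
  exact hasSum_clm (hasSum_bdd hc h2 v) w

lemma harm_bd (h : ℕ → EuclideanSpace ℝ (Fin d) → ℝ) (hh : ∀ m, Hom m (h m))
    {B K r : ℝ} (hB : 0 ≤ B) (hK : 0 ≤ K) (hr : 0 < r)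
    (hnu : ∀ m, nu m (h m) ≤ B * K ^ m) (m : ℕ) (x : EuclideanSpace ℝ (Fin d)) (hx : ‖x‖ < r) :
    ‖h m x‖ ≤ B / r ^ 0 * ((m:ℝ) ^ 0 * (K * r) ^ m) ∧
    ‖fderiv ℝ (h m) x‖ ≤ B / r ^ 1 * ((m:ℝ) ^ 1 * (K * r) ^ m) ∧
    ‖fderiv ℝ (fderiv ℝ (h m)) x‖ ≤ B / r ^ 2 * ((m:ℝ) ^ 2 * (K * r) ^ m) := by
  have hb := fun k => (hh m).iter_bound hB hK hr (hnu m) k x hx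
  refine ⟨?_, ?_, ?_⟩
  · have := hb 0; rw [norm_iteratedFDeriv_zero] at this; exact this
  · have := hb 1
    rw [← norm_iteratedFDeriv_fderiv, norm_iteratedFDeriv_zero] at this; exact this
  · have := hb 2
    rw [← norm_iteratedFDeriv_fderiv, ← norm_iteratedFDeriv_fderiv, norm_iteratedFDeriv_zero] at this
    exact this

lemma harm_sum (h : ℕ → EuclideanSpace ℝ (Fin d) → ℝ) (hh : ∀ m, Hom m (h m))
    (hV : ∀ m x, VL (h m) x = 0) {B K r : ℝ} (hB : 0 ≤ B) (hK : 0 ≤ K) (hr : 0 < r) (hKr : K * r < 1)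
    (hnu : ∀ m, nu m (h m) ≤ B * K ^ m) (x : EuclideanSpace ℝ (Fin d)) (hx : ‖x‖ < r) :
    VL (fun y => ∑' m, h m y) x = 0 := by
  have hKr' : ‖K * r‖ < 1 := by
    rw [Real.norm_of_nonneg (by positivity)]; exact hKr
  have hsum : ∀ k : ℕ, Summable fun m : ℕ => B / r ^ k * ((m:ℝ) ^ k * (K * r) ^ m) := fun k =>
    Summable.mul_left (B / r ^ k) (summable_pow_mul_geometric_of_norm_lt_one (R := ℝ) k hKr')
  have hb := harm_bd h hh hB hK hr hnu
  have s4 := tsum_fd2 hr h (fun m z => cd_diff (hh m).smooth z)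
    (fun m z => cd_diff (cd_fderiv (hh m).smooth) z) (hsum 0) (hsum 1) (hsum 2)
    (fun m => (hb m 0 (by simpa)).1) (fun m y hy => (hb m y hy).2.1) (fun m y hy => (hb m y hy).2.2) x hx
  rw [VL_eq s4.differentiableAt, s4.fderiv]
  have s5 := fun i : Fin d => tsum_fd2_apply h (hsum 2) x (fun m => (hb m x hx).2.2)
    (EuclideanSpace.single i 1) (EuclideanSpace.single i 1)
  have s6 := hasSum_sum (s := Finset.univ) (fun i _ => s5 i)
  have s7 : ∀ m, ∑ i : Fin d, fderiv ℝ (fderiv ℝ (h m)) x (EuclideanSpace.single i 1)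
      (EuclideanSpace.single i 1) = 0 := by
    intro m
    rw [← VL_eq (cd_diff (cd_fderiv (hh m).smooth) x), hV m x]
  simp only [s7] at s6
  exact s6.unique hasSum_zero

end


section
variable {d : ℕ}

lemma sum_analytic (g : ℕ → EuclideanSpace ℝ (Fin d) → ℝ) (hg : ∀ n, Hom n (g n)) {B K r : ℝ}
    (hB : 0 ≤ B) (hK : 0 ≤ K) (hr : 0 < r) (hKr : K * r < 1) (hnu : ∀ n, nu n (g n) ≤ B * K ^ n) :
    ∃ G : EuclideanSpace ℝ (Fin d) → ℝ,
      AnalyticOnNhd ℝ G (Metric.ball (0 : EuclideanSpace ℝ (Fin d)) r) ∧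
      ∀ x, ‖x‖ < r → HasSum (fun n => g n x) (G x) := by
  let p : FormalMultilinearSeries ℝ (EuclideanSpace ℝ (Fin d)) ℝ :=
    fun n => (n.factorial : ℝ)⁻¹ • iteratedFDeriv ℝ n (g n) 0
  have hp : ∀ n, ‖p n‖ = nu n (g n) := by
    intro n
    simp only [p]
    rw [norm_smul, nu, norm_inv, Real.norm_natCast, div_eq_inv_mul]
  have hrad : ENNReal.ofReal r ≤ p.radius := by
    refine p.le_radius_of_bound (r := r.toNNReal) B fun n => ?_
    rw [hp, Real.coe_toNNReal _ hr.le]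
    calc nu n (g n) * r ^ n ≤ B * K ^ n * r ^ n := by
          gcongr; exact hnu n
      _ = B * (K * r) ^ n := by rw [mul_pow]; ring
      _ ≤ B * 1 := by
          gcongr; exact pow_le_one₀ (by positivity) hKr.le
      _ = B := mul_one _
  have hpos : 0 < p.radius := lt_of_lt_of_le (ENNReal.ofReal_pos.2 hr) hrad
  have hmem : ∀ x : EuclideanSpace ℝ (Fin d), ‖x‖ < r → x ∈ Metric.eball (0 : EuclideanSpace ℝ (Fin d)) p.radius := by
    intro x hx
    refine Metric.eball_subset_eball hrad ?_
    rw [Metric.eball_ofReal]; simpa using hx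
  refine ⟨p.sum, fun x hx => ?_, fun x hx => ?_⟩
  · exact (p.hasFPowerSeriesOnBall hpos).analyticOnNhd x (hmem x (by simpa using hx))
  · have := p.hasSum (hmem x hx)
    refine this.congr_fun ?_ |> fun h => h
    intro n
    rw [(hg n).apply x]; simp [p]

lemma quad_le (n : ℕ) : ((n:ℝ) + 2) * (n + 1) ≤ 2 * 4 ^ n := by
  induction n with
  | zero => norm_num
  | succ k ih =>
    push_cast
    rw [pow_succ]
    have : (0:ℝ) ≤ k := by positivity
    nlinarith

lemma assembly (hd : 2 ≤ d) (q : ℕ → EuclideanSpace ℝ (Fin d) → ℝ) (hq : ∀ m, Hom m (q m)) {A C : ℝ}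
    (hA : 0 ≤ A) (hC : 0 ≤ C) (hnu : ∀ m, nu m (q m) ≤ A * C ^ m) :
    ∃ K : ℝ, C ≤ K ∧ 0 < K ∧ ∀ r, 0 < r → K * r < 1 →
      ∃ G H : EuclideanSpace ℝ (Fin d) → ℝ,
      AnalyticOnNhd ℝ G (Metric.ball (0 : EuclideanSpace ℝ (Fin d)) r) ∧
      (∀ x, ‖x‖ < r → VL H x = 0) ∧
      ∀ x S, ‖x‖ < r → HasSum (fun m => q m x) S → S = H x + ‖x‖ ^ 2 * G x := by
  choose g hg hgV hgn using fun n => fischer_hom hd (hq (n + 2))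
  set e := Real.exp d with he
  have he1 : 1 ≤ e := Real.one_le_exp (by positivity)
  set K := 4 * (C + 1) * e with hK
  set B := 2 * A * d * e * (C + 1) ^ 2 with hB
  have hB0 : 0 ≤ B := by positivity
  have hK4 : 4 * (C + 1) ≤ K := by rw [hK]; nlinarith
  have hCK : C ≤ K := by linarith
  have hK1 : 1 ≤ K := by linarith
  have hgB : ∀ n, nu n (g n) ≤ B * K ^ n := by
    intro n
    refine (hgn n).trans ?_
    have e1 : Real.exp (d * (n + 1)) = e * e ^ n := by
      rw [he, ← Real.exp_nat_mul, ← Real.exp_add]; congr 1; ring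
    rw [e1]
    calc _ ≤ e * e ^ n * (d * (2 * 4 ^ n)) * (A * (C + 1) ^ (n + 2)) := by
          have h1 := quad_le n
          have h2 : nu (n + 2) (q (n + 2)) ≤ A * (C + 1) ^ (n + 2) := (hnu _).trans (by
            refine mul_le_mul_of_nonneg_left ?_ hA
            exact pow_le_pow_left₀ hC (by linarith) _)
          refine mul_le_mul ?_ h2 (nu_nonneg _ _) (by positivity)
          refine mul_le_mul_of_nonneg_left ?_ (by positivity)
          exact mul_le_mul_of_nonneg_left h1 (by positivity)
      _ = B * K ^ n := by
          rw [hB, hK, mul_pow, mul_pow]; ring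
  let W : ℕ → EuclideanSpace ℝ (Fin d) → ℝ := fun m => match m with
    | 0 => fun _ => 0
    | 1 => fun _ => 0
    | n + 2 => fun y => ‖y‖ ^ 2 * g n y
  have hzero : ∀ n, Hom n (fun _ : EuclideanSpace ℝ (Fin d) => (0:ℝ)) := fun n =>
    ⟨contDiff_const, fun t x => by simp⟩
  have hnuz : ∀ n, nu n (fun _ : EuclideanSpace ℝ (Fin d) => (0:ℝ)) = 0 := fun n => by
    unfold nu
    have : iteratedFDeriv ℝ n (fun _ : EuclideanSpace ℝ (Fin d) => (0:ℝ)) = 0 := iteratedFDeriv_fun_zero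
    rw [this]; simp
  have hW : ∀ m, Hom m (W m) := fun m => match m with
    | 0 => hzero 0
    | 1 => hzero 1
    | n + 2 => (hg n).nsq_mul
  have hWn : ∀ m, nu m (W m) ≤ B * K ^ m := fun m => match m with
    | 0 => by rw [show W 0 = fun _ => 0 from rfl, hnuz]; positivity
    | 1 => by rw [show W 1 = fun _ => 0 from rfl, hnuz]; positivity
    | n + 2 => ((nu_nsq (hg n).smooth).trans (hgB n)).trans (by
        refine mul_le_mul_of_nonneg_left ?_ hB0
        exact pow_le_pow_right₀ hK1 (by omega))
  let h : ℕ → EuclideanSpace ℝ (Fin d) → ℝ := fun m y => 1 * q m y + (-1) * W m y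
  have hh : ∀ m, Hom m (h m) := fun m => (hq m).lin (hW m) 1 (-1)
  have hhn : ∀ m, nu m (h m) ≤ (A + B) * K ^ m := fun m => by
    refine (nu_lin (hq m).smooth (hW m).smooth 1 (-1)).trans ?_
    have h1 : A * C ^ m ≤ A * K ^ m :=
      mul_le_mul_of_nonneg_left (pow_le_pow_left₀ hC hCK _) hA
    have h2 := hnu m
    have h3 := hWn m
    rw [abs_neg, abs_one]
    linarith
  have hhV : ∀ m x, VL (h m) x = 0 := fun m => match m with
    | 0 => (hh 0).VL_low (by norm_num)
    | 1 => (hh 1).VL_low (by norm_num)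
    | n + 2 => fun x => by
        have : h (n + 2) = fun y => q (n + 2) y - ‖y‖ ^ 2 * g n y := by
          funext y; simp only [h, W]; ring
        rw [this]; exact hgV n x
  refine ⟨K, hCK, by linarith, fun r hr hKr => ?_⟩
  obtain ⟨G, hG, hGs⟩ := sum_analytic g hg hB0 (by linarith) hr hKr hgB
  refine ⟨G, fun y => ∑' m, h m y, hG, fun x hx => ?_, fun x S hx hS => ?_⟩
  · exact harm_sum h hh hhV (add_nonneg hA hB0) (by linarith) hr hKr hhn x hx
  · have h1 : HasSum (fun n => W (n + 2) x) (‖x‖ ^ 2 * G x) := (hGs x hx).mul_left _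
    have h2 := (hasSum_nat_add_iff (f := fun m => W m x) 2).1 h1
    have h3 : ∑ i ∈ Finset.range 2, W i x = 0 := by
      rw [Finset.sum_range_succ, Finset.sum_range_one]; simp [W]
    rw [h3, add_zero] at h2
    have h4 := (hS.mul_left 1).add (h2.mul_left (-1))
    have h5 : ∑' m, h m x = 1 * S + -1 * (‖x‖ ^ 2 * G x) := h4.tsum_eq
    beta_reduce; rw [h5]; ring

end

theorem stmt7 (d : ℕ) (hd : 2 ≤ d)
    (u : EuclideanSpace ℝ (Fin d) → ℝ) (f : ℝ → ℝ)
    (hu : ∀ n : ℕ, ContDiffOn ℝ n u (Metric.ball (0 : EuclideanSpace ℝ (Fin d)) 1))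
    (hf : ∃ a b : ℝ, (∀ x ∈ Metric.ball (0 : EuclideanSpace ℝ (Fin d)) 1, u x ∈ Set.Ioo a b) ∧
      AnalyticOnNhd ℝ f (Set.Ioo a b))
    (hf0 : f 0 = 0)
    (heq : ∀ x ∈ Metric.ball (0 : EuclideanSpace ℝ (Fin d)) 1, lap d u x = f (u x)) :
    ∃ r₀ : ℝ, 0 < r₀ ∧ r₀ < 1 ∧
    ∃ uL g : EuclideanSpace ℝ (Fin d) → ℝ,
      (∀ x ∈ Metric.ball (0 : EuclideanSpace ℝ (Fin d)) r₀, lap d uL x = 0) ∧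
      AnalyticOnNhd ℝ g (Metric.ball (0 : EuclideanSpace ℝ (Fin d)) r₀) ∧
      ∀ x ∈ Metric.ball (0 : EuclideanSpace ℝ (Fin d)) r₀,
        u x = uL x + ‖x‖ ^ 2 * g x := by
  obtain ⟨U, hU, R, A, C, hR, hR1, hA, hC, hUu, hb⟩ := regularity hu hf heq
  have hnu : ∀ m, nu m (fun x => ((m.factorial : ℝ)⁻¹ • iteratedFDeriv ℝ m U 0) (fun _ => x)) ≤
      A * C ^ m := by
    intro m
    refine (diag_nu _).trans ?_
    have h1 := hb m 0 (by simpa using hR)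
    rw [norm_smul, norm_inv, Real.norm_natCast, inv_mul_le_iff₀ (by positivity)]
    linarith
  obtain ⟨K, hCK, hK, hmain⟩ := assembly hd
    (fun m x => ((m.factorial : ℝ)⁻¹ • iteratedFDeriv ℝ m U 0) (fun _ => x))
    (fun m => diag_hom _) hA hC hnu
  have hKi : 0 < 1 / (2 * K) := by positivity
  have hr0 : 0 < min R (1 / (2 * K)) := lt_min hR hKi
  have hKr : K * min R (1 / (2 * K)) < 1 := by
    have h1 : K * min R (1 / (2 * K)) ≤ K * (1 / (2 * K)) :=
      mul_le_mul_of_nonneg_left (min_le_right _ _) hK.le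
    have h2 : K * (1 / (2 * K)) = 1 / 2 := by field_simp
    linarith
  obtain ⟨G, H, hG, hH, hS⟩ := hmain _ hr0 hKr
  refine ⟨_, hr0, lt_of_le_of_lt (min_le_left _ _) hR1, H, G, fun x hx => ?_, hG, fun x hx => ?_⟩
  · exact hH x (by simpa using hx)
  · have hx' : ‖x‖ < min R (1 / (2 * K)) := mem_ball_zero_iff.1 hx
    have hxR : ‖x‖ < R := lt_of_lt_of_le hx' (min_le_left _ _)
    rw [← hUu x hxR]
    refine hS x _ hx' ?_
    have hCx : C * ‖x‖ < 1 := by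
      refine lt_of_le_of_lt ?_ hKr
      exact mul_le_mul hCK hx'.le (norm_nonneg _) hK.le
    have := taylor_sum hU hA hC hb x hxR hCx
    simpa using this
end
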